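/- Let F(x) be the number of ternary integers n = pqr ≤ x (with 3 ≤ p < q < r odd primes) such that the n-th cyclotomic polynomial Φ_n is flat, i.e. h(Φ_n) = 1. Then F(x) ≥ (2C₂ + o(1))·x/log x as x → ∞, where C₂ = (Σ_{p prime} 1/(p(p-1)))². -/

import Mathlib

open Real Filter Polynomial

/-- The height of a polynomial over `ℤ`: the maximum of the absolute values of
its coefficients. -/
noncomputable def polyHeight (f : Polynomial ℤ) : ℕ :=
  f.support.sup fun k => (f.coeff k).natAbs

/-- The constant `C₂ = (Σ_p 1/(p(p-1)))²`, the sum over all primes. -/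
noncomputable def C2 : ℝ :=
  (∑' p : Nat.Primes, 1 / ((p.1 : ℝ) * ((p.1 : ℝ) - 1))) ^ 2

/-- `F(x)`: the number of ternary `n = pqr ≤ x` (with `3 ≤ p < q < r` odd primes)
such that `Φ_n` is flat, i.e. `h(Φ_n) = 1`. -/
noncomputable def Fcount (x : ℝ) : ℕ :=
  {n : ℕ | ∃ p q r : ℕ, p.Prime ∧ q.Prime ∧ r.Prime ∧
    3 ≤ p ∧ p < q ∧ q < r ∧ n = p * q * r ∧ (n : ℝ) ≤ x ∧
    polyHeight (Polynomial.cyclotomic n ℤ) = 1}.ncard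


/-- Explicit coefficients of `Φ_{3q}`. -/
def tA (q i : ℤ) : ℤ :=
  if i < 0 then 0 else
  if i < q then (if i % 3 = 0 then 1 else if i % 3 = 1 then -1 else 0)
  else if i < 2 * q then
    (if q % 3 = 1 then (if i % 3 = 0 then 1 else if i % 3 = 2 then -1 else 0)
      else (if i % 3 = 2 then 1 else if i % 3 = 1 then -1 else 0))
  else 0

/-- truncated coefficient -/
def tB (q N i : ℤ) : ℤ := if i ≤ N then tA q i else 0

set_option maxHeartbeats 1000000 in
lemma tB_diff2 (q N v w d : ℤ) (hq : q % 3 = 2) (hv0 : 0 ≤ v) (hv : v < 3 * q)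
    (hw : (q ≤ v ∧ w = v - q) ∨ (v < q ∧ w = v + 2 * q)) (hd : d = tB q N v - tB q N w) (hN : 0 ≤ N) :
    (v % 3 = 0 ∧ d = 1 ∧ ((v < q ∧ v ≤ N) ∨ (q ≤ v ∧ v ≤ N + q))) ∨
    (v % 3 = 0 ∧ d = 0 ∧ ((v < q ∧ N < v) ∨ (q ≤ v ∧ N + q < v))) ∨
    (v % 3 = 1 ∧ d = -1 ∧ ((v < 2 * q ∧ v ≤ N) ∨ (2 * q ≤ v ∧ v ≤ N + q))) ∨
    (v % 3 = 1 ∧ d = 0) ∨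
    (v % 3 = 2 ∧ d = -1 ∧ q ≤ v ∧ v < 2 * q ∧ N < v ∧ v ≤ N + q) ∨
    (v % 3 = 2 ∧ d = 0) := by
  have h3 : v % 3 = 0 ∨ v % 3 = 1 ∨ v % 3 = 2 := by omega
  have hr : v < q ∨ (q ≤ v ∧ v < 2 * q) ∨ 2 * q ≤ v := by omega
  subst hd
  unfold tB
  rcases hr with hr | hr | hr <;> rcases h3 with h | h | h
  · have e1 : tA q v = 1 := by unfold tA; split_ifs <;> omega
    have hw' : w = v + 2 * q := by omega
    subst hw'
    have e2 : tA q (v + 2 * q) = 0 := by unfold tA; split_ifs <;> omega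
    rw [e1, e2]; split_ifs <;> omega
  · have e1 : tA q v = -1 := by unfold tA; split_ifs <;> omega
    have hw' : w = v + 2 * q := by omega
    subst hw'
    have e2 : tA q (v + 2 * q) = 0 := by unfold tA; split_ifs <;> omega
    rw [e1, e2]; split_ifs <;> omega
  · have e1 : tA q v = 0 := by unfold tA; split_ifs <;> omega
    have hw' : w = v + 2 * q := by omega
    subst hw'
    have e2 : tA q (v + 2 * q) = 0 := by unfold tA; split_ifs <;> omega
    rw [e1, e2]; split_ifs <;> omega
  · have e1 : tA q v = 0 := by unfold tA; split_ifs <;> omega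
    have hw' : w = v - q := by omega
    subst hw'
    have e2 : tA q (v - q) = -1 := by unfold tA; split_ifs <;> omega
    rw [e1, e2]; split_ifs <;> omega
  · have e1 : tA q v = -1 := by unfold tA; split_ifs <;> omega
    have hw' : w = v - q := by omega
    subst hw'
    have e2 : tA q (v - q) = 0 := by unfold tA; split_ifs <;> omega
    rw [e1, e2]; split_ifs <;> omega
  · have e1 : tA q v = 1 := by unfold tA; split_ifs <;> omega
    have hw' : w = v - q := by omega
    subst hw'
    have e2 : tA q (v - q) = 1 := by unfold tA; split_ifs <;> omega
    rw [e1, e2]; split_ifs <;> omega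
  · have e1 : tA q v = 0 := by unfold tA; split_ifs <;> omega
    have hw' : w = v - q := by omega
    subst hw'
    have e2 : tA q (v - q) = -1 := by unfold tA; split_ifs <;> omega
    rw [e1, e2]; split_ifs <;> omega
  · have e1 : tA q v = 0 := by unfold tA; split_ifs <;> omega
    have hw' : w = v - q := by omega
    subst hw'
    have e2 : tA q (v - q) = 1 := by unfold tA; split_ifs <;> omega
    rw [e1, e2]; split_ifs <;> omega
  · have e1 : tA q v = 0 := by unfold tA; split_ifs <;> omega
    have hw' : w = v - q := by omega
    subst hw'
    have e2 : tA q (v - q) = 0 := by unfold tA; split_ifs <;> omega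
    rw [e1, e2]; split_ifs <;> omega

lemma comb2 (q t N v0 v1 v2 w0 w1 w2 : ℤ) (hq : q % 3 = 2) (ht0 : 0 < t) (ht : 2 * t < q)
    (ht3 : t % 3 = 1) (hN : 0 ≤ N)
    (hv0 : 0 ≤ v0) (hv0' : v0 < 3 * q) (hv1 : 0 ≤ v1) (hv1' : v1 < 3 * q)
    (hv2 : 0 ≤ v2) (hv2' : v2 < 3 * q)
    (h1 : v1 = v0 - t ∨ v1 = v0 - t + 3 * q) (h2 : v2 = v1 - t ∨ v2 = v1 - t + 3 * q)
    (hw0 : (q ≤ v0 ∧ w0 = v0 - q) ∨ (v0 < q ∧ w0 = v0 + 2 * q))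
    (hw1 : (q ≤ v1 ∧ w1 = v1 - q) ∨ (v1 < q ∧ w1 = v1 + 2 * q))
    (hw2 : (q ≤ v2 ∧ w2 = v2 - q) ∨ (v2 < q ∧ w2 = v2 + 2 * q)) :
    |(tB q N v0 - tB q N w0) + (tB q N v1 - tB q N w1) + (tB q N v2 - tB q N w2)| ≤ 1 := by
  have a0 := tB_diff2 q N v0 w0 _ hq hv0 hv0' hw0 rfl hN
  have a1 := tB_diff2 q N v1 w1 _ hq hv1 hv1' hw1 rfl hN
  have a2 := tB_diff2 q N v2 w2 _ hq hv2 hv2' hw2 rfl hN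
  generalize tB q N v0 - tB q N w0 = d0 at *
  generalize tB q N v1 - tB q N w1 = d1 at *
  generalize tB q N v2 - tB q N w2 = d2 at *
  clear hw0 hw1 hw2
  rw [abs_le]
  have h3 : v0 % 3 = 0 ∨ v0 % 3 = 1 ∨ v0 % 3 = 2 := by omega
  rcases h1 with h1 | h1 <;> rcases h2 with h2 | h2 <;> rcases h3 with h3 | h3 | h3 <;> omega

set_option maxHeartbeats 1000000 in
lemma tB_diff1 (q N v w d : ℤ) (hq : q % 3 = 1) (hv0 : 0 ≤ v) (hv : v < 3 * q)
    (hw : (v < 2 * q ∧ w = v + q) ∨ (2 * q ≤ v ∧ w = v - 2 * q)) (hd : d = tB q N v - tB q N w)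
    (hN : 0 ≤ N) :
    (v % 3 = 0 ∧ d = 1 ∧ ((v < 2 * q ∧ v ≤ N) ∨ (2 * q ≤ v ∧ v ≤ N + 2 * q))) ∨
    (v % 3 = 0 ∧ d = 0 ∧ ((v < 2 * q ∧ N < v) ∨ (2 * q ≤ v ∧ N + 2 * q < v))) ∨
    (v % 3 = 1 ∧ d = -1 ∧ v < q ∧ v ≤ N ∧ N < v + q) ∨
    (v % 3 = 1 ∧ d = 0) ∨
    (v % 3 = 2 ∧ d = -1 ∧ ((v < q ∧ v + q ≤ N) ∨ (q ≤ v ∧ v < 2 * q ∧ v ≤ N) ∨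
      (2 * q ≤ v ∧ v ≤ N + 2 * q))) ∨
    (v % 3 = 2 ∧ d = 0) := by
  have h3 : v % 3 = 0 ∨ v % 3 = 1 ∨ v % 3 = 2 := by omega
  have hr : v < q ∨ (q ≤ v ∧ v < 2 * q) ∨ 2 * q ≤ v := by omega
  subst hd
  unfold tB
  rcases hr with hr | hr | hr <;> rcases h3 with h | h | h
  · have e1 : tA q v = 1 := by unfold tA; split_ifs <;> omega
    have hw' : w = v + q := by omega
    subst hw'
    have e2 : tA q (v + q) = 0 := by unfold tA; split_ifs <;> omega
    rw [e1, e2]; split_ifs <;> omega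
  · have e1 : tA q v = -1 := by unfold tA; split_ifs <;> omega
    have hw' : w = v + q := by omega
    subst hw'
    have e2 : tA q (v + q) = -1 := by unfold tA; split_ifs <;> omega
    rw [e1, e2]; split_ifs <;> omega
  · have e1 : tA q v = 0 := by unfold tA; split_ifs <;> omega
    have hw' : w = v + q := by omega
    subst hw'
    have e2 : tA q (v + q) = 1 := by unfold tA; split_ifs <;> omega
    rw [e1, e2]; split_ifs <;> omega
  · have e1 : tA q v = 1 := by unfold tA; split_ifs <;> omega
    have hw' : w = v + q := by omega
    subst hw'
    have e2 : tA q (v + q) = 0 := by unfold tA; split_ifs <;> omega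
    rw [e1, e2]; split_ifs <;> omega
  · have e1 : tA q v = 0 := by unfold tA; split_ifs <;> omega
    have hw' : w = v + q := by omega
    subst hw'
    have e2 : tA q (v + q) = 0 := by unfold tA; split_ifs <;> omega
    rw [e1, e2]; split_ifs <;> omega
  · have e1 : tA q v = -1 := by unfold tA; split_ifs <;> omega
    have hw' : w = v + q := by omega
    subst hw'
    have e2 : tA q (v + q) = 0 := by unfold tA; split_ifs <;> omega
    rw [e1, e2]; split_ifs <;> omega
  · have e1 : tA q v = 0 := by unfold tA; split_ifs <;> omega
    have hw' : w = v - 2 * q := by omega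
    subst hw'
    have e2 : tA q (v - 2 * q) = -1 := by unfold tA; split_ifs <;> omega
    rw [e1, e2]; split_ifs <;> omega
  · have e1 : tA q v = 0 := by unfold tA; split_ifs <;> omega
    have hw' : w = v - 2 * q := by omega
    subst hw'
    have e2 : tA q (v - 2 * q) = 0 := by unfold tA; split_ifs <;> omega
    rw [e1, e2]; split_ifs <;> omega
  · have e1 : tA q v = 0 := by unfold tA; split_ifs <;> omega
    have hw' : w = v - 2 * q := by omega
    subst hw'
    have e2 : tA q (v - 2 * q) = 1 := by unfold tA; split_ifs <;> omega
    rw [e1, e2]; split_ifs <;> omega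

set_option maxHeartbeats 1000000 in
lemma comb1 (q t N v0 v1 v2 w0 w1 w2 : ℤ) (hq : q % 3 = 1) (ht0 : 0 < t) (ht : 2 * t < q)
    (ht3 : t % 3 = 2) (hN : 0 ≤ N)
    (hv0 : 0 ≤ v0) (hv0' : v0 < 3 * q) (hv1 : 0 ≤ v1) (hv1' : v1 < 3 * q)
    (hv2 : 0 ≤ v2) (hv2' : v2 < 3 * q)
    (h1 : v1 = v0 - t ∨ v1 = v0 - t + 3 * q) (h2 : v2 = v1 - t ∨ v2 = v1 - t + 3 * q)
    (hw0 : (v0 < 2 * q ∧ w0 = v0 + q) ∨ (2 * q ≤ v0 ∧ w0 = v0 - 2 * q))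
    (hw1 : (v1 < 2 * q ∧ w1 = v1 + q) ∨ (2 * q ≤ v1 ∧ w1 = v1 - 2 * q))
    (hw2 : (v2 < 2 * q ∧ w2 = v2 + q) ∨ (2 * q ≤ v2 ∧ w2 = v2 - 2 * q)) :
    |(tB q N v0 - tB q N w0) + (tB q N v1 - tB q N w1) + (tB q N v2 - tB q N w2)| ≤ 1 := by
  have a0 := tB_diff1 q N v0 w0 _ hq hv0 hv0' hw0 rfl hN
  have a1 := tB_diff1 q N v1 w1 _ hq hv1 hv1' hw1 rfl hN
  have a2 := tB_diff1 q N v2 w2 _ hq hv2 hv2' hw2 rfl hN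
  generalize tB q N v0 - tB q N w0 = d0 at *
  generalize tB q N v1 - tB q N w1 = d1 at *
  generalize tB q N v2 - tB q N w2 = d2 at *
  clear hw0 hw1 hw2
  rw [abs_le]
  have h3 : v0 % 3 = 0 ∨ v0 % 3 = 1 ∨ v0 % 3 = 2 := by omega
  rcases h1 with h1 | h1 <;> rcases h2 with h2 | h2 <;> rcases h3 with h3 | h3 | h3 <;> omega


/-- integer-indexed coefficient -/
noncomputable def zc (P : ℤ[X]) (z : ℤ) : ℤ := if 0 ≤ z then P.coeff z.toNat else 0

lemma zc_neg (P : ℤ[X]) {z : ℤ} (h : z < 0) : zc P z = 0 := by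
  unfold zc; rw [if_neg (by omega)]

lemma zc_nat (P : ℤ[X]) (n : ℕ) : zc P n = P.coeff n := by simp [zc]

lemma zc_mul_X_pow (P : ℤ[X]) (k : ℕ) (z : ℤ) : zc (P * X ^ k) z = zc P (z - k) := by
  unfold zc
  split_ifs with h1 h2 h2
  · rw [coeff_mul_X_pow', if_pos (by omega)]
    congr 1; omega
  · rw [coeff_mul_X_pow', if_neg (by omega)]
  · omega
  · rfl

lemma zc_add (P Q : ℤ[X]) (z : ℤ) : zc (P + Q) z = zc P z + zc Q z := by
  unfold zc; split_ifs <;> simp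

lemma zc_sub (P Q : ℤ[X]) (z : ℤ) : zc (P - Q) z = zc P z - zc Q z := by
  unfold zc; split_ifs <;> simp

lemma zc_one (z : ℤ) : zc 1 z = if z = 0 then 1 else 0 := by
  unfold zc
  by_cases h : 0 ≤ z
  · rw [if_pos h, coeff_one]; congr 1; simp; omega
  · rw [if_neg h, if_neg (by omega)]

lemma zc_X_pow (k : ℕ) (z : ℤ) : zc (X ^ k) z = if z = k then 1 else 0 := by
  have := zc_mul_X_pow 1 k z
  rw [one_mul] at this
  rw [this, zc_one]; congr 1; simp; omega

lemma zc_expand (P : ℤ[X]) (r : ℕ) (hr : 0 < r) (z : ℤ) :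
    zc (expand ℤ r P) z = if (r : ℤ) ∣ z then zc P (z / r) else 0 := by
  have hr' : (0 : ℤ) < r := by exact_mod_cast hr
  by_cases h : 0 ≤ z
  · obtain ⟨n, rfl⟩ := Int.eq_ofNat_of_zero_le h
    rw [zc_nat, coeff_expand hr, ← Int.natCast_div, zc_nat]
    norm_cast
  · rw [zc_neg _ (by omega), zc_neg]
    · simp
    · by_contra h'
      rw [not_lt, Int.le_ediv_iff_mul_le hr', zero_mul] at h'
      exact h h'

lemma cyc3q (q : ℕ) (hq : q.Prime) (hq3 : 3 < q) :
    cyclotomic (3 * q) ℤ * (X ^ 2 + X + 1) = X ^ (2 * q) + X ^ q + 1 := by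
  have h : ¬ q ∣ 3 := fun h => by have := Nat.le_of_dvd (by norm_num) h; omega
  have := cyclotomic_expand_eq_cyclotomic_mul hq h ℤ
  rw [cyclotomic_three] at this
  rw [← this]
  simp [expand_eq_comp_X_pow, ← pow_mul]
  ring

lemma zc_cyc3q_aux (q : ℕ) (hq : q.Prime) (hq3 : 3 < q) (z : ℤ) :
    zc (cyclotomic (3 * q) ℤ) (z - 2) + zc (cyclotomic (3 * q) ℤ) (z - 1) +
      zc (cyclotomic (3 * q) ℤ) z =
    (if z = 2 * q then 1 else 0) + (if z = q then 1 else 0) + (if z = 0 then 1 else 0) := by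
  have h := congrArg (fun P => zc P z) (cyc3q q hq hq3)
  simp only [zc_add, zc_X_pow, zc_one] at h
  have e : cyclotomic (3 * q) ℤ * (X ^ 2 + X + 1) = cyclotomic (3 * q) ℤ * X ^ 2 +
    cyclotomic (3 * q) ℤ * X ^ 1 + cyclotomic (3 * q) ℤ * X ^ 0 := by ring
  rw [e] at h
  simp only [zc_add, zc_mul_X_pow] at h
  push_cast at h
  rw [sub_zero] at h
  exact h

lemma tA_neg (q i : ℤ) (h : i < 0) : tA q i = 0 := by unfold tA; rw [if_pos h]

lemma tA_lo (q i : ℤ) (h0 : 0 ≤ i) (h : i < q) :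
    tA q i = (if i % 3 = 0 then 1 else if i % 3 = 1 then -1 else 0) := by
  unfold tA; rw [if_neg (by omega), if_pos h]

lemma tA_mid (q i : ℤ) (h0 : 0 ≤ i) (h : q ≤ i) (h2 : i < 2 * q) :
    tA q i = if q % 3 = 1 then (if i % 3 = 0 then 1 else if i % 3 = 2 then -1 else 0)
      else (if i % 3 = 2 then 1 else if i % 3 = 1 then -1 else 0) := by
  unfold tA; rw [if_neg (by omega), if_neg (by omega), if_pos h2]

lemma tA_hi (q i : ℤ) (h0 : 0 < q) (h : 2 * q ≤ i) : tA q i = 0 := by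
  unfold tA; rw [if_neg (by omega), if_neg (by omega), if_neg (by omega)]

lemma tA_rec (q z : ℤ) (hq : 3 < q) (h3 : q % 3 = 1 ∨ q % 3 = 2) :
    tA q (z - 2) + tA q (z - 1) + tA q z =
    (if z = 2 * q then 1 else 0) + (if z = q then 1 else 0) + (if z = 0 then 1 else 0) := by
  rcases lt_or_ge z 0 with h | h
  · rw [if_neg (by omega), if_neg (by omega), if_neg (by omega), tA_neg _ _ h, tA_neg _ (z - 1) (by omega), tA_neg _ (z - 2) (by omega)]

  rcases eq_or_ne z 0 with rfl | h0
  · rw [if_neg (by omega), if_neg (by omega), tA_neg _ (0 - 1) (by omega), tA_neg _ (0 - 2) (by omega), tA_lo _ _ (by omega) (by omega)]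
    norm_num
  rcases eq_or_ne z 1 with rfl | h1
  · rw [if_neg (by omega), if_neg (by omega), tA_neg _ (1 - 2) (by omega), tA_lo _ (1 - 1) (by omega) (by omega), tA_lo _ 1 (by omega) (by omega)]
    norm_num
  rw [if_neg h0]
  rcases lt_or_ge z q with h2 | h2
  · rw [if_neg (by omega), if_neg (by omega), tA_lo _ z (by omega) (by omega), tA_lo _ (z - 1) (by omega) (by omega), tA_lo _ (z - 2) (by omega) (by omega)]
    split_ifs <;> omega
  rcases eq_or_ne z q with h4 | h4
  · rw [if_neg (by omega), if_pos h4, tA_mid _ z (by omega) (by omega) (by omega), tA_lo _ (z - 1) (by omega) (by omega), tA_lo _ (z - 2) (by omega) (by omega)]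
    split_ifs <;> omega
  rw [if_neg h4]
  rcases eq_or_ne z (q + 1) with h5 | h5
  · rw [if_neg (by omega), tA_mid _ z (by omega) (by omega) (by omega), tA_mid _ (z - 1) (by omega) (by omega) (by omega), tA_lo _ (z - 2) (by omega) (by omega)]
    split_ifs <;> omega
  rcases lt_or_ge z (2 * q) with h6 | h6
  · rw [if_neg (by omega), tA_mid _ z (by omega) (by omega) (by omega), tA_mid _ (z - 1) (by omega) (by omega) (by omega), tA_mid _ (z - 2) (by omega) (by omega) (by omega)]
    split_ifs <;> omega
  rw [tA_hi q z (by omega) h6]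
  rcases eq_or_ne z (2 * q) with h7 | h7
  · rw [if_pos h7, tA_mid _ (z - 1) (by omega) (by omega) (by omega), tA_mid _ (z - 2) (by omega) (by omega) (by omega)]
    split_ifs <;> omega
  rw [if_neg h7, tA_hi q (z - 1) (by omega) (by omega)]
  rcases eq_or_ne z (2 * q + 1) with h8 | h8
  · rw [tA_mid _ (z - 2) (by omega) (by omega) (by omega)]
    split_ifs <;> omega
  rw [tA_hi q (z - 2) (by omega) (by omega)]

lemma zc_cyc3q (q : ℕ) (hq : q.Prime) (hq3 : 3 < q) (z : ℤ) :
    zc (cyclotomic (3 * q) ℤ) z = tA q z := by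
  have h3 : (q : ℤ) % 3 = 1 ∨ (q : ℤ) % 3 = 2 := by
    have : ¬ 3 ∣ q := fun h => by
      have := (Nat.prime_dvd_prime_iff_eq Nat.prime_three hq).1 h; omega
    omega
  have hneg : ∀ z : ℤ, z < 0 → zc (cyclotomic (3 * q) ℤ) z = tA q z := fun z hz => by
    rw [zc_neg _ hz]; unfold tA; rw [if_pos hz]
  have main : ∀ n : ℕ, ∀ z : ℤ, z < n → zc (cyclotomic (3 * q) ℤ) z = tA q z := by
    intro n
    induction n with
    | zero => intro z hz; exact hneg z (by simpa using hz)
    | succ n ih =>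
      intro z hz
      push_cast at hz
      have a := zc_cyc3q_aux q hq hq3 z
      have b := tA_rec q z (by exact_mod_cast hq3) h3
      rw [ih (z - 2) (by omega), ih (z - 1) (by omega)] at a
      linarith
  exact main (z.toNat + 1) z (by omega)


lemma cyc3qr (q r : ℕ) (hq : q.Prime) (hr : r.Prime) (hq3 : 3 < q) (hqr : q < r) :
    cyclotomic (3 * q * r) ℤ * (X ^ (3 * q) - 1) =
      expand ℤ r (cyclotomic (3 * q) ℤ) * ((X ^ 2 + X + 1) * (X ^ q - 1)) := by
  have h : ¬ r ∣ 3 * q := fun h => by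
    rcases (Nat.Prime.dvd_mul hr).1 h with h | h
    · have := Nat.le_of_dvd (by norm_num) h; omega
    · have := Nat.le_of_dvd (by omega) h; omega
  rw [cyclotomic_expand_eq_cyclotomic_mul hr h ℤ]
  have e : (X ^ (3 * q) - 1 : ℤ[X]) = (X ^ (2 * q) + X ^ q + 1) * (X ^ q - 1) := by
    rw [mul_comm 3 q, mul_comm 2 q, pow_mul, pow_mul]; ring
  rw [e, ← cyc3q q hq hq3]
  ring

lemma zc_cyc3qr (q r : ℕ) (hq : q.Prime) (hr : r.Prime) (hq3 : 3 < q) (hqr : q < r) (E : ℤ → ℤ)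
    (hE : ∀ z, E z = if (r : ℤ) ∣ z then tA q (z / r) else 0) (z : ℤ) :
    zc (cyclotomic (3 * q * r) ℤ) (z - 3 * q) - zc (cyclotomic (3 * q * r) ℤ) z =
      E (z - (q + 2)) + E (z - (q + 1)) + E (z - q) - E (z - 2) - E (z - 1) - E z := by
  have h := congrArg (fun P => zc P z) (cyc3qr q r hq hr hq3 hqr)
  have hE' : ∀ z, zc (expand ℤ r (cyclotomic (3 * q) ℤ)) z = E z := fun z => by
    rw [zc_expand _ _ hr.pos, hE, zc_cyc3q q hq hq3]
  generalize expand ℤ r (cyclotomic (3 * q) ℤ) = P at *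
  have e : P * ((X ^ 2 + X + 1) * (X ^ q - 1)) = P * X ^ (q + 2) + P * X ^ (q + 1) + P * X ^ q
    - P * X ^ 2 - P * X ^ 1 - P * X ^ 0 := by ring
  rw [e, mul_sub, mul_one] at h
  simp only [zc_sub, zc_add, zc_mul_X_pow, hE'] at h
  push_cast at h
  rw [sub_zero] at h
  exact h

/-- one Kaplan term -/
def tT (q r t z m : ℤ) : ℤ :=
  if r * ((t * (z - m)) % (3 * q)) + m ≤ z then tA q ((t * (z - m)) % (3 * q)) else 0

lemma tT_diff (q r t z m : ℤ) (hq : 0 < q) (hr : 0 < r) (h : 3 * q ∣ r * t - 1) :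
    tT q r t z m - tT q r t (z - 3 * q) m =
      if r ∣ (z - m) then tA q ((z - m) / r) else 0 := by
  unfold tT
  have e0 : (t * (z - 3 * q - m)) % (3 * q) = (t * (z - m)) % (3 * q) := by
    rw [show t * (z - 3 * q - m) = t * (z - m) + (3 * q) * (-t) by ring, Int.add_mul_emod_self_left]
  rw [e0]
  have hf0 : 0 ≤ (t * (z - m)) % (3 * q) := Int.emod_nonneg _ (by omega)
  have hf1 : (t * (z - m)) % (3 * q) < 3 * q := Int.emod_lt_of_pos _ (by omega)
  have hd := Int.emod_add_mul_ediv (t * (z - m)) (3 * q)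
  set f := (t * (z - m)) % (3 * q) with hf
  obtain ⟨c, hc⟩ := h
  have hk : ∃ k, r * f - (z - m) = 3 * q * k := by
    refine ⟨c * (z - m) - r * (t * (z - m) / (3 * q)), ?_⟩
    have : f = t * (z - m) - 3 * q * (t * (z - m) / (3 * q)) := by linarith
    rw [this]
    linear_combination (z - m) * hc
  obtain ⟨k, hk⟩ := hk
  have hi : ∀ i, z - m = r * i → 0 ≤ i → i < 3 * q → i = f := by
    intro i hi h0 h1
    have : f = i % (3 * q) := by
      rw [hf, hi, show t * (r * i) = i + 3 * q * (c * i) by linear_combination i * hc,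
        Int.add_mul_emod_self_left]
    rw [this, Int.emod_eq_of_lt h0 h1]
  by_cases hz : r * f = z - m
  · rw [if_pos (by omega), if_neg (by omega), if_pos (Dvd.intro _ hz), ← hz,
      Int.mul_ediv_cancel_left _ (by omega), sub_zero]
  · have lhs0 : (if r * f + m ≤ z then tA q f else 0) - (if r * f + m ≤ z - 3 * q then tA q f else 0) = 0 := by
      by_cases h1 : r * f + m ≤ z
      · rw [if_pos h1, if_pos, sub_self]
        have hk0 : k < 0 := by
          by_contra hk0
          have : 0 ≤ 3 * q * k := mul_nonneg (by omega) (by omega)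
          omega
        nlinarith
      · rw [if_neg h1, if_neg (by omega), sub_self]
    rw [lhs0]
    split_ifs with h2
    · obtain ⟨i, hi'⟩ := h2
      rw [hi', Int.mul_ediv_cancel_left _ (by omega)]
      by_cases h0 : i < 0
      · rw [tA_neg _ _ h0]
      by_cases h1 : i < 3 * q
      · exact absurd (by rw [hi', hi i hi' (by omega) h1]) hz
      · rw [tA_hi _ _ hq (by omega)]
    · rfl

lemma tT_neg (q r t z m : ℤ) (hq : 0 < q) (hr : 0 < r) (hm : 0 ≤ m) (hz : z < 0) :
    tT q r t z m = 0 := by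
  unfold tT
  have hf0 : 0 ≤ (t * (z - m)) % (3 * q) := Int.emod_nonneg _ (by omega)
  have := mul_nonneg hr.le hf0
  rw [if_neg (by omega)]

lemma kaplan (q r : ℕ) (t : ℤ) (hq : q.Prime) (hr : r.Prime) (hq3 : 3 < q) (hqr : q < r)
    (h : (3 * q : ℤ) ∣ r * t - 1) (z : ℤ) :
    zc (cyclotomic (3 * q * r) ℤ) z =
      (tT q r t z 0 - tT q r t z q) + (tT q r t z 1 - tT q r t z (q + 1)) +
        (tT q r t z 2 - tT q r t z (q + 2)) := by
  have hr0 : (0 : ℤ) < r := by exact_mod_cast hr.pos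
  have hq0 : (0 : ℤ) < q := by exact_mod_cast hq.pos
  have main : ∀ n : ℕ, ∀ z : ℤ, z < n → zc (cyclotomic (3 * q * r) ℤ) z =
      (tT q r t z 0 - tT q r t z q) + (tT q r t z 1 - tT q r t z (q + 1)) +
        (tT q r t z 2 - tT q r t z (q + 2)) := by
    intro n
    induction n with
    | zero =>
      intro z hz
      have hz : z < 0 := by simpa using hz
      rw [zc_neg _ hz]
      simp only [tT_neg q r t z 0 hq0 hr0 (by omega) hz, tT_neg q r t z 1 hq0 hr0 (by omega) hz,
        tT_neg q r t z 2 hq0 hr0 (by omega) hz, tT_neg q r t z q hq0 hr0 (by omega) hz,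
        tT_neg q r t z (q + 1) hq0 hr0 (by omega) hz, tT_neg q r t z (q + 2) hq0 hr0 (by omega) hz]
      norm_num
    | succ n ih =>
      intro z hz
      push_cast at hz
      have a := zc_cyc3qr q r hq hr hq3 hqr _ (fun z => rfl) z
      rw [ih (z - 3 * q) (by omega)] at a
      have d := fun m => tT_diff q r t z m hq0 hr0 h
      have d0 := d 0
      have d1 := d 1
      have d2 := d 2
      have d3 := d q
      have d4 := d (q + 1)
      have d5 := d (q + 2)
      rw [sub_zero] at d0
      simp only [← d0, ← d1, ← d2, ← d3, ← d4, ← d5] at a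
      linarith
  exact main (z.toNat + 1) z (by omega)

lemma tT_eq_tB (q r t z m : ℤ) (hq : 0 < q) (hr : 0 < r) (h : 3 * q ∣ r * t - 1) (hm : 0 ≤ m)
    (hm' : m < 3 * q) :
    tT q r t z m = tB q (z / r) ((t * (z - m)) % (3 * q)) := by
  unfold tT tB
  have hd := Int.emod_add_mul_ediv (t * (z - m)) (3 * q)
  set f := (t * (z - m)) % (3 * q) with hf
  obtain ⟨c, hc⟩ := h
  have hk : ∃ k, r * f - (z - m) = 3 * q * k := by
    refine ⟨c * (z - m) - r * (t * (z - m) / (3 * q)), ?_⟩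
    have : f = t * (z - m) - 3 * q * (t * (z - m) / (3 * q)) := by linarith
    rw [this]
    linear_combination (z - m) * hc
  obtain ⟨k, hk⟩ := hk
  have : (r * f + m ≤ z) ↔ f ≤ z / r := by
    rw [Int.le_ediv_iff_mul_le hr, mul_comm f r]
    constructor
    · intro h; omega
    · intro h
      have hk0 : k < 1 := by
        by_contra hk0
        have : 3 * q * 1 ≤ 3 * q * k := by
          apply mul_le_mul_of_nonneg_left <;> omega
        omega
      have : 3 * q * k ≤ 0 := mul_nonpos_of_nonneg_of_nonpos (by omega) (by omega)
      omega
  simp only [this]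

lemma emod_cases (a D : ℤ) (h0 : -D ≤ a) (h1 : a < D) (hD : 0 < D) :
    (0 ≤ a ∧ a % D = a) ∨ (a < 0 ∧ a % D = a + D) := by
  by_cases h : 0 ≤ a
  · exact Or.inl ⟨h, Int.emod_eq_of_lt h h1⟩
  · refine Or.inr ⟨by omega, ?_⟩
    rw [← Int.add_emod_right, Int.emod_eq_of_lt (by omega) (by omega)]

lemma abs_coeff_le (q r : ℕ) (t : ℤ) (hq : q.Prime) (hr : r.Prime) (hq3 : 3 < q) (hqr : q < r)
    (h : (3 * q : ℤ) ∣ r * t - 1) (ht0 : 0 < t) (ht : 2 * t < q) (ht3 : (3 : ℤ) ∣ t + q) (n : ℕ) :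
    |(cyclotomic (3 * q * r) ℤ).coeff n| ≤ 1 := by
  have hr0 : (0 : ℤ) < r := by exact_mod_cast hr.pos
  have hq0 : (3 : ℤ) < q := by exact_mod_cast hq3
  have h3 : (q : ℤ) % 3 = 1 ∨ (q : ℤ) % 3 = 2 := by
    have : ¬ 3 ∣ q := fun h => by
      have := (Nat.prime_dvd_prime_iff_eq Nat.prime_three hq).1 h; omega
    omega
  rw [← zc_nat, kaplan q r t hq hr hq3 hqr h]
  rw [tT_eq_tB _ _ _ _ 0 (by omega) hr0 h (by omega) (by omega),
    tT_eq_tB _ _ _ _ 1 (by omega) hr0 h (by omega) (by omega),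
    tT_eq_tB _ _ _ _ 2 (by omega) hr0 h (by omega) (by omega),
    tT_eq_tB _ _ _ _ (q : ℤ) (by omega) hr0 h (by omega) (by omega),
    tT_eq_tB _ _ _ _ (q + 1 : ℤ) (by omega) hr0 h (by omega) (by omega),
    tT_eq_tB _ _ _ _ (q + 2 : ℤ) (by omega) hr0 h (by omega) (by omega)]
  have hN : (0 : ℤ) ≤ (n : ℤ) / r := Int.ediv_nonneg (by omega) hr0.le
  generalize (n : ℤ) / r = N at *
  generalize (n : ℤ) = z at *
  have lo : ∀ a : ℤ, 0 ≤ a % (3 * q) := fun a => Int.emod_nonneg _ (by omega)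
  have hi : ∀ a : ℤ, a % (3 * q) < 3 * q := fun a => Int.emod_lt_of_pos _ (by omega)
  have sh : ∀ a b : ℤ, (a + b) % (3 * q) = (a % (3 * q) + b) % (3 * q) := fun a b => by
    rw [Int.emod_add_emod]
  have step : ∀ m : ℤ, (t * (z - (m + 1))) % (3 * q) = (t * (z - m)) % (3 * q) - t ∨
      (t * (z - (m + 1))) % (3 * q) = (t * (z - m)) % (3 * q) - t + 3 * q := fun m => by
    have e : t * (z - (m + 1)) = t * (z - m) + (-t) := by ring
    rw [e, sh]
    have l := lo (t * (z - m))
    have u := hi (t * (z - m))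
    have := emod_cases ((t * (z - m)) % (3 * q) + -t) (3 * q) (by omega) (by omega) (by omega)
    omega
  have s0 := step 0
  have s1 := step 1
  norm_num only at s0 s1
  rcases h3 with h3 | h3
  · obtain ⟨s, hs⟩ : ∃ s, t = 3 * s + 2 := ⟨t / 3, by omega⟩
    have stepq : ∀ m : ℤ, ((t * (z - m)) % (3 * q) < 2 * q ∧ (t * (z - (q + m))) % (3 * q) = (t * (z - m)) % (3 * q) + q) ∨
      (2 * q ≤ (t * (z - m)) % (3 * q) ∧ (t * (z - (q + m))) % (3 * q) = (t * (z - m)) % (3 * q) - 2 * q) := fun m => by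
      have e : t * (z - (q + m)) = t * (z - m) + (-2 * q) + 3 * q * (-s) := by
        linear_combination (-q : ℤ) * hs
      rw [e, Int.add_mul_emod_self_left, sh]
      have l := lo (t * (z - m))
      have u := hi (t * (z - m))
      have := emod_cases ((t * (z - m)) % (3 * q) + -2 * q) (3 * q) (by omega) (by omega) (by omega)
      omega
    have q0 := stepq 0
    rw [add_zero] at q0
    exact comb1 q t N _ _ _ _ _ _ h3 ht0 ht (by omega) hN (lo _) (hi _) (lo _) (hi _) (lo _) (hi _)
      s0 s1 q0 (stepq 1) (stepq 2)
  · obtain ⟨s, hs⟩ : ∃ s, t = 3 * s + 1 := ⟨t / 3, by omega⟩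
    have stepq : ∀ m : ℤ, (q ≤ (t * (z - m)) % (3 * q) ∧ (t * (z - (q + m))) % (3 * q) = (t * (z - m)) % (3 * q) - q) ∨
      ((t * (z - m)) % (3 * q) < q ∧ (t * (z - (q + m))) % (3 * q) = (t * (z - m)) % (3 * q) + 2 * q) := fun m => by
      have e : t * (z - (q + m)) = t * (z - m) + (-q) + 3 * q * (-s) := by
        linear_combination (-q : ℤ) * hs
      rw [e, Int.add_mul_emod_self_left, sh]
      have l := lo (t * (z - m))
      have u := hi (t * (z - m))
      have := emod_cases ((t * (z - m)) % (3 * q) + -q) (3 * q) (by omega) (by omega) (by omega)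
      omega
    have q0 := stepq 0
    rw [add_zero] at q0
    exact comb2 q t N _ _ _ _ _ _ h3 ht0 ht (by omega) hN (lo _) (hi _) (lo _) (hi _) (lo _) (hi _)
      s0 s1 q0 (stepq 1) (stepq 2)

lemma flat_of (q r : ℕ) (t : ℤ) (hq : q.Prime) (hr : r.Prime) (hq3 : 3 < q) (hqr : q < r)
    (h : (3 * q : ℤ) ∣ r * t - 1) (ht0 : 0 < t) (ht : 2 * t < q) (ht3 : (3 : ℤ) ∣ t + q) :
    polyHeight (cyclotomic (3 * q * r) ℤ) = 1 := by
  have hb := abs_coeff_le q r t hq hr hq3 hqr h ht0 ht ht3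
  unfold polyHeight
  apply le_antisymm
  · apply Finset.sup_le
    intro k _
    have := hb k
    rw [Int.abs_eq_natAbs] at this
    exact_mod_cast this
  · obtain ⟨k, hk⟩ := Polynomial.support_nonempty.2 (cyclotomic_ne_zero (3 * q * r) ℤ)
    refine le_trans ?_ (Finset.le_sup hk)
    rw [mem_support_iff] at hk
    exact Int.natAbs_pos.2 hk


noncomputable def ph (t : ℝ) : ℝ := 1 - t + Real.sin (2 * π * t) / (2 * π)

lemma ph_cont : Continuous ph := by unfold ph; fun_prop

lemma abs_ph_le {t : ℝ} (h0 : 0 ≤ t) (h1 : t ≤ 1) : |ph t| ≤ 2 := by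
  unfold ph
  have h2 : |Real.sin (2 * π * t) / (2 * π)| ≤ 1 := by
    rw [abs_div, abs_of_pos (by positivity : 0 < 2 * π), div_le_one (by positivity)]
    have := Real.abs_sin_le_one (2 * π * t)
    have := Real.pi_gt_three
    linarith
  have h3 : |1 - t| ≤ 1 := by rw [abs_le]; constructor <;> linarith
  exact (abs_add_le _ _).trans (by linarith)

noncomputable def gk (u : ℝ) : ℝ := ∫ t in (0:ℝ)..1, ph t * Real.cos (t * u)

lemma gk_le (u : ℝ) : gk u ≤ 2 := by
  have := intervalIntegral.norm_integral_le_of_norm_le_const (a := 0) (b := 1) (C := 2)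
    (f := fun t => ph t * Real.cos (t * u)) (by
      intro t ht
      rw [Set.uIoc_of_le (by norm_num)] at ht
      rw [Real.norm_eq_abs, abs_mul]
      have h1 := abs_ph_le ht.1.le ht.2
      have h2 := Real.abs_cos_le_one (t * u)
      nlinarith [abs_nonneg (ph t), abs_nonneg (Real.cos (t*u))])
  rw [Real.norm_eq_abs] at this
  have h2 := le_abs_self (gk u)
  unfold gk at *
  norm_num at this
  linarith

lemma gk_eq (u : ℝ) (hu : u ≠ 0) (h1 : 2 * π + u ≠ 0) (h2 : 2 * π - u ≠ 0) :
    gk u = (1 - Real.cos u) / u ^ 2 + (1 - Real.cos u) / ((2 * π + u) * (2 * π - u)) := by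
  have hpi := Real.pi_ne_zero
  unfold gk
  rw [intervalIntegral.integral_eq_sub_of_hasDerivAt (f := fun t =>
    (1 - t) * Real.sin (t * u) / u - Real.cos (t * u) / u ^ 2
     - (1 / (4 * π)) * (Real.cos ((2 * π + u) * t) / (2 * π + u)
        + Real.cos ((2 * π - u) * t) / (2 * π - u)))]
  · have e1 : Real.cos ((2 * π + u) * 1) = Real.cos u := by
      rw [mul_one, add_comm, Real.cos_add_two_pi]
    have e2 : Real.cos ((2 * π - u) * 1) = Real.cos u := by
      rw [mul_one, Real.cos_two_pi_sub]
    have e3 : ∀ c : ℝ, (1 / (4 * π)) * (c / (2 * π + u) + c / (2 * π - u))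
        = c / ((2 * π + u) * (2 * π - u)) := by
      intro c
      have hab : (2 * π + u) + (2 * π - u) = 4 * π := by ring
      generalize 2 * π + u = a at *
      generalize 2 * π - u = b at *
      rw [← hab]
      have : a + b ≠ 0 := by rw [hab]; positivity
      field_simp
      ring
    simp only [e1, e2, mul_zero, zero_mul, Real.cos_zero, Real.sin_zero, e3]
    ring
  · intro t _
    have d1 : HasDerivAt (fun t : ℝ => Real.sin (t * u)) (Real.cos (t * u) * (1 * u)) t :=
      ((hasDerivAt_id t).mul_const u).sin
    have d2 : HasDerivAt (fun t : ℝ => Real.cos (t * u)) (-Real.sin (t * u) * (1 * u)) t :=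
      ((hasDerivAt_id t).mul_const u).cos
    have d3 : HasDerivAt (fun t : ℝ => Real.cos ((2 * π + u) * t))
        (-Real.sin ((2 * π + u) * t) * ((2 * π + u) * 1)) t :=
      ((hasDerivAt_id t).const_mul (2 * π + u)).cos
    have d4 : HasDerivAt (fun t : ℝ => Real.cos ((2 * π - u) * t))
        (-Real.sin ((2 * π - u) * t) * ((2 * π - u) * 1)) t :=
      ((hasDerivAt_id t).const_mul (2 * π - u)).cos
    have d0 : HasDerivAt (fun t : ℝ => 1 - t) (-1) t := by
      simpa using (hasDerivAt_id t).const_sub 1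
    have := ((((d0.mul d1).div_const u).sub (d2.div_const (u ^ 2))).sub
      (((d3.div_const (2 * π + u)).add (d4.div_const (2 * π - u))).const_mul (1 / (4 * π))))
    refine this.congr_deriv ?_
    unfold ph
    have s1 : Real.sin ((2 * π + u) * t) = Real.sin (2 * π * t) * Real.cos (t * u)
        + Real.cos (2 * π * t) * Real.sin (t * u) := by
      rw [← Real.sin_add]; congr 1; ring
    have s2 : Real.sin ((2 * π - u) * t) = Real.sin (2 * π * t) * Real.cos (t * u)
        - Real.cos (2 * π * t) * Real.sin (t * u) := by
      rw [← Real.sin_sub]; congr 1; ring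
    rw [mul_one, mul_one, mul_div_cancel_right₀ _ h1, mul_div_cancel_right₀ _ h2, s1, s2]
    field_simp
    ring
  · apply Continuous.intervalIntegrable
    have := ph_cont
    fun_prop

lemma gk_nonpos (u : ℝ) (hu : 2 * π < |u|) : gk u ≤ 0 := by
  have hpi := Real.pi_pos
  have hu2 : (2 * π) ^ 2 < u ^ 2 := by
    rw [← sq_abs u]; exact pow_lt_pow_left₀ hu (by positivity) (by norm_num)
  have hprod : (2 * π + u) * (2 * π - u) < 0 := by nlinarith
  have h0 : u ≠ 0 := by rintro rfl; simp at hu; linarith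
  have h1 : 2 * π + u ≠ 0 := by intro h; rw [h] at hprod; simp at hprod
  have h2 : 2 * π - u ≠ 0 := by intro h; rw [h] at hprod; simp at hprod
  rw [gk_eq u h0 h1 h2]
  have e : (1 - Real.cos u) / u ^ 2 + (1 - Real.cos u) / ((2 * π + u) * (2 * π - u))
     = (1 - Real.cos u) * ((2 * π) ^ 2 / (u ^ 2 * ((2 * π + u) * (2 * π - u)))) := by
    field_simp
    ring
  rw [e]
  apply mul_nonpos_of_nonneg_of_nonpos
  · linarith [Real.cos_le_one u]
  · apply div_nonpos_of_nonneg_of_nonpos (by positivity)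
    exact mul_nonpos_of_nonneg_of_nonpos (by positivity) hprod.le

/-- Riemann–Lebesgue on `[0,1]`. -/
lemma rl01 (f : ℝ → ℂ) :
    Tendsto (fun L : ℝ => ∫ t in (0:ℝ)..1, Complex.exp (t * L * Complex.I) * f t) atTop (nhds 0) := by
  have h := Real.tendsto_integral_exp_smul_cocompact (Set.indicator (Set.Ioc 0 1) f)
  have h2 : Tendsto (fun L : ℝ => (-(1 / (2 * π))) * L) atTop (cocompact ℝ) := by
    refine Tendsto.mono_right ?_ atBot_le_cocompact
    exact tendsto_id.const_mul_atTop_of_neg (by have := Real.pi_pos; simp; positivity)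
  refine (h.comp h2).congr ?_
  intro L
  simp only [Function.comp]
  rw [intervalIntegral.integral_of_le (by norm_num), ← MeasureTheory.integral_indicator
    measurableSet_Ioc]
  congr 1
  ext t
  by_cases ht : t ∈ Set.Ioc (0:ℝ) 1
  · simp only [Set.indicator_of_mem ht]
    rw [Circle.smul_def, Real.fourierChar_apply, smul_eq_mul]
    congr 2
    push_cast
    have := Real.pi_ne_zero
    have : (π : ℂ) ≠ 0 := by exact_mod_cast this
    field_simp
  · simp [Set.indicator_of_notMem ht]


lemma term_re (f : ℕ → ℝ) (σ L t : ℝ) (n : ℕ) (hn : n ≠ 0) :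
    ((ph t : ℂ) * Complex.exp (t * L * Complex.I) *
      LSeries.term (fun n => (f n : ℂ)) (σ + t * Complex.I) n).re
    = (f n * Real.exp (-σ * Real.log n)) * (ph t * Real.cos (t * (L - Real.log n))) := by
  rw [LSeries.term_of_ne_zero hn, Complex.cpow_def_of_ne_zero (by exact_mod_cast hn),
    div_eq_mul_inv, ← Complex.exp_neg]
  have : (ph t : ℂ) * Complex.exp (t * L * Complex.I) *
      (f n * Complex.exp (-(Complex.log n * (σ + t * Complex.I))))
     = ((ph t * f n * Real.exp (-σ * Real.log n) : ℝ) : ℂ)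
      * Complex.exp ((t * (L - Real.log n) : ℝ) * Complex.I) := by
    push_cast
    rw [show (ph t : ℂ) * Complex.exp (t * L * Complex.I) *
      (f n * Complex.exp (-(Complex.log n * (σ + t * Complex.I))))
      = ph t * f n * (Complex.exp (t * L * Complex.I) *
       Complex.exp (-(Complex.log n * (σ + t * Complex.I)))) by ring]
    rw [mul_assoc (ph t * f n : ℂ), ← Complex.exp_add, ← Complex.exp_add]
    congr 2
    ring
  rw [this, Complex.re_ofReal_mul, Complex.exp_ofReal_mul_I_re]
  ring

lemma swap_hasSum (f : ℕ → ℝ) (hf0 : f 0 = 0) (σ L : ℝ)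
    (hs : LSeriesSummable (fun n => (f n : ℂ)) σ) :
    HasSum (fun n : ℕ => (f n * Real.exp (-σ * Real.log n)) * gk (L - Real.log n))
      (∫ t in (0:ℝ)..1, (ph t : ℂ) * Complex.exp (t * L * Complex.I) *
        LSeries (fun n => (f n : ℂ)) (σ + t * Complex.I)).re := by
  have hs' : ∀ t : ℝ, LSeriesSummable (fun n => (f n : ℂ)) (σ + t * Complex.I) := by
    intro t
    exact (LSeriesSummable_iff_of_re_eq_re (by simp)).1 hs
  have hc : ∀ n : ℕ, Continuous (fun t : ℝ => (ph t : ℂ) * Complex.exp (t * L * Complex.I) *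
        LSeries.term (fun n => (f n : ℂ)) (σ + t * Complex.I) n) := by
    intro n
    have := ph_cont
    by_cases hn : n = 0
    · subst hn; simp only [LSeries.term_zero, mul_zero]; exact continuous_const
    · have hn' : (n : ℂ) ≠ 0 := by exact_mod_cast hn
      simp only [LSeries.term_of_ne_zero hn, Complex.cpow_def_of_ne_zero hn', div_eq_mul_inv,
        ← Complex.exp_neg]
      fun_prop
  have key : HasSum (fun n : ℕ => ∫ t in (0:ℝ)..1, (ph t : ℂ) * Complex.exp (t * L * Complex.I) *
        LSeries.term (fun n => (f n : ℂ)) (σ + t * Complex.I) n)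
      (∫ t in (0:ℝ)..1, (ph t : ℂ) * Complex.exp (t * L * Complex.I) *
        LSeries (fun n => (f n : ℂ)) (σ + t * Complex.I)) := by
    apply intervalIntegral.hasSum_integral_of_dominated_convergence
      (bound := fun n _ => 2 * ‖LSeries.term (fun n => (f n : ℂ)) σ n‖)
    · intro n
      exact (hc n).aestronglyMeasurable
    · intro n
      refine Eventually.of_forall fun t ht => ?_
      rw [Set.uIoc_of_le (by norm_num)] at ht
      rw [norm_mul, norm_mul, Complex.norm_real]
      have e1 : ‖Complex.exp (t * L * Complex.I)‖ = 1 := by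
        rw [← Complex.ofReal_mul]; exact Complex.norm_exp_ofReal_mul_I _
      have e2 : ‖LSeries.term (fun n => (f n : ℂ)) (σ + t * Complex.I) n‖ =
          ‖LSeries.term (fun n => (f n : ℂ)) σ n‖ := by
        rw [LSeries.norm_term_eq, LSeries.norm_term_eq]; simp
      rw [e1, e2, mul_one]
      exact mul_le_mul_of_nonneg_right (abs_ph_le ht.1.le ht.2) (norm_nonneg _)
    · exact Eventually.of_forall fun t _ => hs.norm.mul_left 2
    · exact intervalIntegrable_const
    · refine Eventually.of_forall fun t _ => ?_
      exact (hs' t).hasSum.mul_left _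
  have := Complex.hasSum_re key
  convert this using 2 with n
  rw [show (∫ t in (0:ℝ)..1, (ph t : ℂ) * Complex.exp (t * L * Complex.I) *
        LSeries.term (fun n => (f n : ℂ)) (σ + t * Complex.I) n).re =
        ∫ t in (0:ℝ)..1, ((ph t : ℂ) * Complex.exp (t * L * Complex.I) *
        LSeries.term (fun n => (f n : ℂ)) (σ + t * Complex.I) n).re from
      (Complex.reCLM.intervalIntegral_comp_comm ((hc n).intervalIntegrable 0 1)).symm]
  by_cases hn : n = 0
  · subst hn; simp [hf0]
  · simp_rw [term_re f σ L _ n hn]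
    rw [intervalIntegral.integral_const_mul]
    rfl

lemma swap_bound (f : ℕ → ℝ) (hf0 : f 0 = 0) (hf : ∀ n, 0 ≤ f n) (σ x : ℝ) (hσ : 1 < σ)
    (hx : 0 < x) (hs : LSeriesSummable (fun n => (f n : ℂ)) σ) :
    (∫ t in (0:ℝ)..1, (ph t : ℂ) * Complex.exp (t * Real.log x * Complex.I) *
        LSeries (fun n => (f n : ℂ)) (σ + t * Complex.I)).re ≤
    2 * Real.exp (2 * π) / x *
      ∑ n ∈ Finset.range (⌊x * Real.exp (2 * π)⌋₊ + 1), f n := by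
  have h1 := swap_hasSum f hf0 σ (Real.log x) hs
  have h2 : HasSum (fun n : ℕ => if n ∈ Finset.range (⌊x * Real.exp (2 * π)⌋₊ + 1) then
      2 * Real.exp (2 * π) / x * f n else 0) (2 * Real.exp (2 * π) / x *
      ∑ n ∈ Finset.range (⌊x * Real.exp (2 * π)⌋₊ + 1), f n) := by
    have := hasSum_sum_of_ne_finset_zero (L := SummationFilter.unconditional ℕ) (s := Finset.range (⌊x * Real.exp (2 * π)⌋₊ + 1))
      (f := fun n : ℕ => if n ∈ Finset.range (⌊x * Real.exp (2 * π)⌋₊ + 1) then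
      2 * Real.exp (2 * π) / x * f n else 0) (fun b hb => if_neg hb)
    rw [Finset.mul_sum]
    convert this using 1
    exact Finset.sum_congr rfl fun n hn => (if_pos hn).symm
  refine hasSum_le ?_ h1 h2
  intro n
  have hR : 0 ≤ (if n ∈ Finset.range (⌊x * Real.exp (2 * π)⌋₊ + 1) then
      2 * Real.exp (2 * π) / x * f n else 0) := by
    have := hf n
    split_ifs
    · positivity
    · exact le_rfl
  by_cases hn : n = 0
  · refine le_trans (le_of_eq ?_) hR
    simp [hn, hf0]
  by_cases hg : gk (Real.log x - Real.log n) ≤ 0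
  · refine le_trans ?_ hR
    exact mul_nonpos_of_nonneg_of_nonpos (mul_nonneg (hf n) (Real.exp_pos _).le) hg
  · have hu : |Real.log x - Real.log n| ≤ 2 * π := by
      by_contra h
      exact hg (gk_nonpos _ (not_le.1 h))
    rw [abs_le] at hu
    have hn0 : (0:ℝ) < n := by exact_mod_cast Nat.pos_of_ne_zero hn
    have hn1 : (1:ℝ) ≤ n := by exact_mod_cast Nat.pos_of_ne_zero hn
    have hmem : n ∈ Finset.range (⌊x * Real.exp (2 * π)⌋₊ + 1) := by
      rw [Finset.mem_range, Nat.lt_succ_iff]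
      apply Nat.le_floor
      calc (n : ℝ) = Real.exp (Real.log n) := (Real.exp_log hn0).symm
        _ ≤ Real.exp (Real.log x + 2 * π) := Real.exp_le_exp.2 (by linarith)
        _ = x * Real.exp (2 * π) := by rw [Real.exp_add, Real.exp_log hx]
    rw [if_pos hmem]
    have hln : 0 ≤ Real.log n := Real.log_nonneg hn1
    have hb : Real.exp (-σ * Real.log n) ≤ Real.exp (2 * π) / x := by
      calc Real.exp (-σ * Real.log n) ≤ Real.exp (2 * π - Real.log x) :=
            Real.exp_le_exp.2 (by nlinarith)
        _ = _ := by rw [Real.exp_sub, Real.exp_log hx]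
    have hg2 := gk_le (Real.log x - Real.log n)
    have hE := Real.exp_pos (-σ * Real.log n)
    calc f n * Real.exp (-σ * Real.log n) * gk (Real.log x - Real.log n)
        ≤ f n * Real.exp (-σ * Real.log n) * 2 :=
          mul_le_mul_of_nonneg_left hg2 (mul_nonneg (hf n) hE.le)
      _ ≤ f n * (Real.exp (2 * π) / x) * 2 := by
          have := hf n
          gcongr
      _ = _ := by ring


lemma fej_nonneg (L : ℝ) : 0 ≤ ∫ t in (0:ℝ)..1, (1 - t) * Real.cos (t * L) := by
  by_cases hL : L = 0
  · subst hL
    apply intervalIntegral.integral_nonneg (by norm_num)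
    intro t ht
    simp only [mul_zero, Real.cos_zero, mul_one]
    linarith [ht.2]
  · rw [intervalIntegral.integral_eq_sub_of_hasDerivAt (f := fun t =>
      (1 - t) * Real.sin (t * L) / L - Real.cos (t * L) / L ^ 2)]
    · have : 0 ≤ (1 - Real.cos L) / L ^ 2 :=
        div_nonneg (by linarith [Real.cos_le_one L]) (by positivity)
      simp
      rw [sub_div] at this
      rw [inv_eq_one_div]
      linarith
    · intro t _
      have d1 : HasDerivAt (fun t : ℝ => Real.sin (t * L)) (Real.cos (t * L) * (1 * L)) t :=
        ((hasDerivAt_id t).mul_const L).sin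
      have d2 : HasDerivAt (fun t : ℝ => Real.cos (t * L)) (-Real.sin (t * L) * (1 * L)) t :=
        ((hasDerivAt_id t).mul_const L).cos
      have d0 : HasDerivAt (fun t : ℝ => 1 - t) (-1) t := by
        simpa using (hasDerivAt_id t).const_sub 1
      refine (((d0.mul d1).div_const L).sub (d2.div_const (L ^ 2))).congr_deriv ?_
      field_simp
      ring
    · apply Continuous.intervalIntegrable
      fun_prop

lemma sin_div_eq (t L : ℝ) : (1 - t) * (Real.sin (t * L) / t) = 
   if t = 0 then 0 else (1 - t) * (L * Real.sinc (t * L)) := by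
  split_ifs with h
  · simp [h]
  · by_cases hL : L = 0
    · simp [hL]
    · rw [Real.sinc_of_ne_zero (by positivity)]
      field_simp

lemma I_intble (L : ℝ) : IntervalIntegrable (fun t : ℝ => (1 - t) * (Real.sin (t * L) / t))
    MeasureTheory.volume 0 1 := by
  have hc : Continuous (fun t : ℝ => (1 - t) * (L * Real.sinc (t * L))) := by
    have := Real.continuous_sinc
    fun_prop
  refine (hc.intervalIntegrable 0 1).congr ?_
  intro t ht
  rw [Set.uIoc_of_le (by norm_num)] at ht
  dsimp only
  rw [sin_div_eq, if_neg ht.1.ne']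

lemma I_nonneg (L : ℝ) (hL : 0 ≤ L) :
    0 ≤ ∫ t in (0:ℝ)..1, (1 - t) * (Real.sin (t * L) / t) := by
  have hd : ∀ L : ℝ, HasDerivAt (fun L : ℝ => ∫ t in (0:ℝ)..1, (1 - t) * (Real.sin (t * L) / t))
      (∫ t in (0:ℝ)..1, (1 - t) * Real.cos (t * L)) L := by
    intro L
    refine (intervalIntegral.hasDerivAt_integral_of_dominated_loc_of_deriv_le
      (F := fun L t : ℝ => (1 - t) * (Real.sin (t * L) / t))
      (F' := fun L t : ℝ => (1 - t) * Real.cos (t * L)) (bound := fun _ => 1)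
      (s := Set.univ) Filter.univ_mem ?_ (I_intble L) ?_ ?_ ?_ ?_).2
    · exact Eventually.of_forall fun L => (by fun_prop : Measurable _).aestronglyMeasurable
    · exact (by fun_prop : Continuous _).aestronglyMeasurable
    · refine Eventually.of_forall fun t ht y _ => ?_
      rw [Set.uIoc_of_le (by norm_num)] at ht
      rw [Real.norm_eq_abs, abs_mul, abs_of_nonneg (by linarith [ht.2])]
      have := Real.abs_cos_le_one (t * y)
      nlinarith [ht.1, ht.2, abs_nonneg (Real.cos (t * y))]
    · exact intervalIntegrable_const
    · refine Eventually.of_forall fun t ht y _ => ?_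
      rw [Set.uIoc_of_le (by norm_num)] at ht
      have ht0 := ht.1.ne'
      have d1 : HasDerivAt (fun y : ℝ => Real.sin (t * y)) (Real.cos (t * y) * (t * 1)) y :=
        ((hasDerivAt_id y).const_mul t).sin
      refine ((d1.div_const t).const_mul (1 - t)).congr_deriv ?_
      field_simp
  have hm : Monotone (fun L : ℝ => ∫ t in (0:ℝ)..1, (1 - t) * (Real.sin (t * L) / t)) := by
    apply monotone_of_deriv_nonneg
    · exact fun L => (hd L).differentiableAt
    · intro L
      rw [(hd L).deriv]
      exact fej_nonneg L
  simpa using hm hL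

lemma R_tendsto : Tendsto (fun L : ℝ => ∫ t in (0:ℝ)..1, Real.sinc (2 * π * t) * Real.sin (t * L))
    atTop (nhds 0) := by
  have h := rl01 (fun t => (Real.sinc (2 * π * t) : ℂ))
  have h2 := (Complex.continuous_im.tendsto 0).comp h
  simp only [Complex.zero_im] at h2
  refine h2.congr ?_
  intro L
  simp only [Function.comp]
  have hc : Continuous (fun t : ℝ => Complex.exp (t * L * Complex.I) * (Real.sinc (2 * π * t) : ℂ)) := by
    have := Real.continuous_sinc
    fun_prop
  refine (Complex.imCLM.intervalIntegral_comp_comm (hc.intervalIntegrable 0 1)).symm.trans ?_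
  congr 1
  ext t
  rw [Complex.imCLM_apply, mul_comm, Complex.im_ofReal_mul, ← Complex.ofReal_mul,
    Complex.exp_ofReal_mul_I_im]

lemma J_lower : ∀ᶠ L : ℝ in atTop, -(1/4) ≤ ∫ t in (0:ℝ)..1, ph t * (Real.sin (t * L) / t) := by
  have h := R_tendsto.eventually (lt_mem_nhds (show -(1/4:ℝ) < 0 by norm_num))
  filter_upwards [h, eventually_ge_atTop 0] with L h1 h2
  have e : ∫ t in (0:ℝ)..1, ph t * (Real.sin (t * L) / t) =
      (∫ t in (0:ℝ)..1, (1 - t) * (Real.sin (t * L) / t)) +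
      ∫ t in (0:ℝ)..1, Real.sinc (2 * π * t) * Real.sin (t * L) := by
    rw [← intervalIntegral.integral_add (I_intble L)
      ((by have := Real.continuous_sinc; fun_prop : Continuous _).intervalIntegrable 0 1)]
    apply intervalIntegral.integral_congr_ae
    refine Eventually.of_forall fun t ht => ?_
    rw [Set.uIoc_of_le (by norm_num)] at ht
    have ht0 := ht.1
    have := Real.pi_pos
    rw [Real.sinc_of_ne_zero (by positivity)]
    unfold ph
    field_simp
  rw [e]
  have := I_nonneg L h2
  linarith

lemma arctan_int (e : ℝ) (he : 0 < e) : ∫ t in (0:ℝ)..1, e / (e ^ 2 + t ^ 2) = Real.arctan (1 / e) := by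
  rw [intervalIntegral.integral_eq_sub_of_hasDerivAt (f := fun t => Real.arctan (t / e))]
  · simp
  · intro t _
    refine (((hasDerivAt_id t).div_const e).arctan).congr_deriv ?_
    simp only [id]
    have : 0 < e ^ 2 + t ^ 2 := by positivity
    field_simp
  · apply Continuous.intervalIntegrable
    refine continuous_const.div (by fun_prop) fun t => by positivity

lemma pole_re (e t L : ℝ) (he : 0 < e) :
    ((ph t : ℂ) * Complex.exp (t * L * Complex.I) * (1 / (e + t * Complex.I))).re
    = e / (e ^ 2 + t ^ 2) + (e * (ph t * Real.cos (t * L) - 1) + t * (ph t * Real.sin (t * L)))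
       / (e ^ 2 + t ^ 2) := by
  have hp : 0 < e ^ 2 + t ^ 2 := by positivity
  have h1 : (1 : ℂ) / (e + t * Complex.I) = ((e / (e ^ 2 + t ^ 2) : ℝ) : ℂ)
      - ((t / (e ^ 2 + t ^ 2) : ℝ) : ℂ) * Complex.I := by
    have hne : (e + t * Complex.I : ℂ) ≠ 0 := by
      intro h
      have := congrArg Complex.re h
      simp at this
      linarith
    have hne2 : ((e : ℂ) ^ 2 + t ^ 2) ≠ 0 := by exact_mod_cast hp.ne'
    push_cast
    rw [div_eq_iff hne]
    field_simp
    ring_nf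
    rw [Complex.I_sq]
    ring
  rw [h1, mul_assoc, Complex.re_ofReal_mul, ← Complex.ofReal_mul, Complex.mul_re,
    Complex.exp_ofReal_mul_I_re, Complex.exp_ofReal_mul_I_im]
  have r1 : ∀ a b : ℝ, ((a : ℂ) - (b : ℂ) * Complex.I).re = a := by intro a b; simp
  have r2 : ∀ a b : ℝ, ((a : ℂ) - (b : ℂ) * Complex.I).im = -b := by intro a b; simp
  rw [r1, r2]
  field_simp
  ring

lemma ph_bound (t L : ℝ) (h0 : 0 < t) (h1 : t ≤ 1) :
    |ph t * Real.cos (t * L) - 1| ≤ (2 + L ^ 2 / 2) * t := by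
  have hpi := Real.pi_pos
  have hA : |ph t - 1| ≤ 2 * t := by
    have : |Real.sin (2 * π * t) / (2 * π)| ≤ t := by
      rw [abs_div, abs_of_pos (by positivity : 0 < 2 * π), div_le_iff₀ (by positivity)]
      have := Real.abs_sin_le_abs (x := 2 * π * t)
      rw [abs_of_pos (by positivity : 0 < 2 * π * t)] at this
      linarith
    rw [abs_le] at this ⊢
    unfold ph
    constructor <;> linarith
  have hB : |Real.cos (t * L) - 1| ≤ L ^ 2 / 2 * t := by
    have h2 := Real.one_sub_sq_div_two_le_cos (x := t * L)
    have h3 := Real.cos_le_one (t * L)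
    rw [abs_le]
    have : (t * L) ^ 2 / 2 ≤ L ^ 2 / 2 * t := by
      have := sq_nonneg L
      nlinarith [mul_nonneg h0.le (mul_nonneg this (sub_nonneg.2 h1))]
    constructor
    · linarith
    · have : 0 ≤ L ^ 2 / 2 * t := by positivity
      linarith
  have hC := Real.abs_cos_le_one (t * L)
  calc |ph t * Real.cos (t * L) - 1| = |(ph t - 1) * Real.cos (t * L) + (Real.cos (t * L) - 1)| := by
        congr 1; ring
    _ ≤ |ph t - 1| * |Real.cos (t * L)| + |Real.cos (t * L) - 1| := by
        rw [← abs_mul]; exact abs_add_le _ _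
    _ ≤ 2 * t * 1 + L ^ 2 / 2 * t := by gcongr
    _ = _ := by ring

lemma pole_tendsto (L : ℝ) : Tendsto (fun e : ℝ =>
    (∫ t in (0:ℝ)..1, (ph t : ℂ) * Complex.exp (t * L * Complex.I) *
        (1 / (e + t * Complex.I))).re) (nhdsWithin 0 (Set.Ioi 0))
    (nhds (π / 2 + ∫ t in (0:ℝ)..1, ph t * (Real.sin (t * L) / t))) := by
  have hcont := ph_cont
  have hc1 : ∀ e : ℝ, 0 < e → Continuous (fun t : ℝ => e / (e ^ 2 + t ^ 2)) := fun e he =>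
    continuous_const.div (by fun_prop) fun t => by positivity
  have hc2 : ∀ e : ℝ, 0 < e → Continuous (fun t : ℝ =>
      (e * (ph t * Real.cos (t * L) - 1) + t * (ph t * Real.sin (t * L))) / (e ^ 2 + t ^ 2)) :=
    fun e he => Continuous.div (by fun_prop) (by fun_prop) fun t => by positivity
  have hA : Tendsto (fun e : ℝ => Real.arctan (1 / e)) (nhdsWithin 0 (Set.Ioi 0)) (nhds (π / 2)) := by
    have := Real.tendsto_arctan_atTop.mono_right nhdsWithin_le_nhds
    refine this.comp ?_
    exact (tendsto_inv_nhdsGT_zero (𝕜 := ℝ)).congr fun e => (one_div e).symm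
  have hB : Tendsto (fun e : ℝ => ∫ t in (0:ℝ)..1,
      (e * (ph t * Real.cos (t * L) - 1) + t * (ph t * Real.sin (t * L))) / (e ^ 2 + t ^ 2))
      (nhdsWithin 0 (Set.Ioi 0)) (nhds (∫ t in (0:ℝ)..1, ph t * (Real.sin (t * L) / t))) := by
    apply intervalIntegral.tendsto_integral_filter_of_dominated_convergence
      (bound := fun _ => (2 + L ^ 2 / 2) + 2 * |L|)
    · filter_upwards [self_mem_nhdsWithin] with e he
      exact (hc2 e he).aestronglyMeasurable
    · filter_upwards [self_mem_nhdsWithin] with e he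
      refine Eventually.of_forall fun t ht => ?_
      rw [Set.uIoc_of_le (by norm_num)] at ht
      have he' : 0 < e := he
      have ht0 := ht.1
      rw [Real.norm_eq_abs, abs_div, abs_of_pos (by positivity : 0 < e ^ 2 + t ^ 2),
        div_le_iff₀ (by positivity)]
      have b1 := ph_bound t L ht.1 ht.2
      have b2 := abs_ph_le ht.1.le ht.2
      have b3 : |Real.sin (t * L)| ≤ t * |L| := by
        have := Real.abs_sin_le_abs (x := t * L)
        rwa [abs_mul, abs_of_pos ht0] at this
      calc _ ≤ e * |ph t * Real.cos (t * L) - 1| + t * (|ph t| * |Real.sin (t * L)|) := by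
            refine (abs_add_le _ _).trans (le_of_eq ?_)
            rw [abs_mul, abs_mul, abs_mul, abs_of_pos ht0, abs_of_pos he']
        _ ≤ e * ((2 + L ^ 2 / 2) * t) + t * (2 * (t * |L|)) := by gcongr
        _ = (2 + L ^ 2 / 2) * (e * t) + 2 * |L| * t ^ 2 := by ring
        _ ≤ (2 + L ^ 2 / 2) * (e ^ 2 + t ^ 2) + 2 * |L| * (e ^ 2 + t ^ 2) := by
            gcongr
            · nlinarith [sq_nonneg (e - t), mul_pos he' ht0]
            · nlinarith [sq_nonneg e]
        _ = _ := by ring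
    · exact intervalIntegrable_const
    · refine Eventually.of_forall fun t ht => ?_
      rw [Set.uIoc_of_le (by norm_num)] at ht
      have ht0 := ht.1
      have hcat : ContinuousAt (fun e : ℝ => (e * (ph t * Real.cos (t * L) - 1)
          + t * (ph t * Real.sin (t * L))) / (e ^ 2 + t ^ 2)) 0 := by
        refine ContinuousAt.div (by fun_prop) (by fun_prop) (by positivity)
      have := hcat.tendsto.mono_left (nhdsWithin_le_nhds (s := Set.Ioi 0))
      refine this.trans (le_of_eq ?_)
      congr 1
      field_simp
      ring
  refine (hA.add hB).congr' ?_
  filter_upwards [self_mem_nhdsWithin] with e he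
  have he' : 0 < e := he
  rw [← arctan_int e he, ← intervalIntegral.integral_add ((hc1 e he).intervalIntegrable 0 1)
    ((hc2 e he).intervalIntegrable 0 1)]
  have hc : Continuous (fun t : ℝ => (ph t : ℂ) * Complex.exp (t * L * Complex.I) *
        (1 / (e + t * Complex.I))) := by
    refine Continuous.mul (by fun_prop) (continuous_const.div (by fun_prop) ?_)
    intro t h
    have := congrArg Complex.re h
    simp at this
    linarith
  refine Eq.trans ?_ (Complex.reCLM.intervalIntegral_comp_comm (hc.intervalIntegrable 0 1))
  congr 1
  ext t
  exact (pole_re e t L he').symm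


open ArithmeticFunction.vonMangoldt in
lemma psi_aux {m : ℕ} [NeZero m] (a : ZMod m) (ha : IsUnit a) (x : ℝ) (hx : 0 < x) :
    (∫ t in (0:ℝ)..1, Complex.exp (t * Real.log x * Complex.I) *
      ((ph t : ℂ) * LFunctionResidueClassAux a (1 + t * Complex.I))).re +
    (m.totient : ℝ)⁻¹ * (π / 2 + ∫ t in (0:ℝ)..1, ph t * (Real.sin (t * Real.log x) / t)) ≤
    2 * Real.exp (2 * π) / x *
      ∑ n ∈ Finset.range (⌊x * Real.exp (2 * π)⌋₊ + 1), residueClass a n := by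
  have hph := ph_cont
  have hG := continuousOn_LFunctionResidueClassAux a
  have hGc : ContinuousOn (fun p : ℝ × ℝ =>
      LFunctionResidueClassAux a (1 + p.1 + p.2 * Complex.I)) (Set.Ici 0 ×ˢ Set.univ) := by
    refine hG.comp (by fun_prop) ?_
    intro p hp
    have := hp.1
    simp at this
    simpa using this
  obtain ⟨C, hC⟩ := (isCompact_Icc.prod isCompact_Icc :
    IsCompact (Set.Icc (0:ℝ) 1 ×ˢ Set.Icc (0:ℝ) 1)).exists_bound_of_continuousOn
    (hGc.mono (by
      rintro ⟨u, v⟩ ⟨h1, h2⟩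
      exact ⟨h1.1, Set.mem_univ _⟩))
  have hGt : ∀ e : ℝ, 0 ≤ e → Continuous (fun t : ℝ =>
      LFunctionResidueClassAux a (1 + e + t * Complex.I)) := by
    intro e he
    rw [← continuousOn_univ]
    exact hGc.comp (f := fun t : ℝ => (e, t)) (by fun_prop) (fun t _ => ⟨he, Set.mem_univ _⟩)
  have hE : Tendsto (fun e : ℝ => ∫ t in (0:ℝ)..1, Complex.exp (t * Real.log x * Complex.I) *
      ((ph t : ℂ) * LFunctionResidueClassAux a (1 + e + t * Complex.I)))
      (nhdsWithin 0 (Set.Ioi 0)) (nhds (∫ t in (0:ℝ)..1,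
      Complex.exp (t * Real.log x * Complex.I) *
      ((ph t : ℂ) * LFunctionResidueClassAux a (1 + t * Complex.I)))) := by
    apply intervalIntegral.tendsto_integral_filter_of_dominated_convergence
      (bound := fun _ => 2 * C)
    · filter_upwards [self_mem_nhdsWithin] with e he
      have := hGt e (le_of_lt he)
      exact (by fun_prop : Continuous _).aestronglyMeasurable
    · filter_upwards [self_mem_nhdsWithin, nhdsWithin_le_nhds (Iio_mem_nhds (zero_lt_one))]
        with e he he1
      refine Eventually.of_forall fun t ht => ?_
      rw [Set.uIoc_of_le (by norm_num)] at ht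
      have e1 : ‖Complex.exp (t * Real.log x * Complex.I)‖ = 1 := by
        rw [← Complex.ofReal_mul]; exact Complex.norm_exp_ofReal_mul_I _
      rw [norm_mul, norm_mul, e1, one_mul, Complex.norm_real]
      have h1 := hC (e, t) ⟨⟨le_of_lt he, le_of_lt he1⟩, ⟨ht.1.le, ht.2⟩⟩
      exact mul_le_mul (abs_ph_le ht.1.le ht.2) h1 (norm_nonneg _) (by norm_num)
    · exact intervalIntegrable_const
    · refine Eventually.of_forall fun t ht => ?_
      refine Tendsto.const_mul _ (Tendsto.const_mul _ ?_)
      have h1 : ContinuousWithinAt (fun e : ℝ => LFunctionResidueClassAux a (1 + e + t * Complex.I))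
          (Set.Ici 0) 0 := by
        have : ContinuousOn (fun e : ℝ => LFunctionResidueClassAux a (1 + e + t * Complex.I))
          (Set.Ici 0) :=
          hGc.comp (f := fun e : ℝ => (e, t)) (by fun_prop) (fun e he => ⟨he, Set.mem_univ _⟩)
        exact this 0 Set.self_mem_Ici
      have h2 := h1.mono Set.Ioi_subset_Ici_self
      simpa [ContinuousWithinAt] using h2
  have hE' := (Complex.continuous_re.tendsto _).comp hE
  have hP := (pole_tendsto (Real.log x)).const_mul ((m.totient : ℝ)⁻¹)
  refine le_of_tendsto (hE'.add hP) ?_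
  filter_upwards [self_mem_nhdsWithin] with e he
  have he' : 0 < e := he
  have hsum : LSeriesSummable (fun n => (residueClass a n : ℂ)) ((1 + e : ℝ) : ℂ) := by
    apply LSeriesSummable_of_abscissaOfAbsConv_lt_re
    refine (abscissaOfAbsConv_residueClass_le_one a).trans_lt ?_
    rw [Complex.ofReal_re]
    exact_mod_cast (by linarith : (1:ℝ) < 1 + e)
  have hb := swap_bound (residueClass a) (residueClass_apply_zero a) (residueClass_nonneg a) (1 + e) x
    (by linarith) hx hsum
  refine le_trans (le_of_eq ?_) hb
  simp only [Function.comp]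
  have hne : ∀ t : ℝ, (e + t * Complex.I : ℂ) ≠ 0 := by
    intro t h
    have := congrArg Complex.re h
    simp at this
    linarith
  have hc2 : Continuous (fun t : ℝ => (ph t : ℂ) * Complex.exp (t * Real.log x * Complex.I) *
        (1 / (e + t * Complex.I))) :=
    Continuous.mul (by fun_prop) (continuous_const.div (by fun_prop) hne)
  rw [← Complex.re_ofReal_mul, ← Complex.add_re, ← intervalIntegral.integral_const_mul,
    ← intervalIntegral.integral_add]
  · congr 2
    ext t
    have h1 : (1 : ℝ) < ((1 : ℂ) + e + t * Complex.I).re := by simp; exact he'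
    rw [eqOn_LFunctionResidueClassAux ha h1]
    push_cast
    rw [show (1 : ℂ) + e + t * Complex.I - 1 = e + t * Complex.I by ring]
    have := hne t
    field_simp
    ring
  · have := hGt e he'.le
    exact (by fun_prop : Continuous _).intervalIntegrable 0 1
  · exact (continuous_const.mul hc2).intervalIntegrable 0 1

open ArithmeticFunction.vonMangoldt in
lemma psi_lower {m : ℕ} [NeZero m] (a : ZMod m) (ha : IsUnit a) :
    ∀ᶠ y : ℝ in atTop, (1 / (2 * Real.exp (4 * π))) * y / m.totient ≤
      ∑ n ∈ Finset.range (⌊y⌋₊ + 1), residueClass a n := by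
  have hA : (0:ℝ) < (m.totient : ℝ)⁻¹ := by
    have := Nat.totient_pos.2 (NeZero.pos m)
    positivity
  have hR := rl01 (fun t => (ph t : ℂ) * LFunctionResidueClassAux a (1 + t * Complex.I))
  have hR' := (Complex.continuous_re.tendsto 0).comp hR
  rw [Complex.zero_re] at hR'
  have h1 := hR'.eventually (lt_mem_nhds (show -((m.totient : ℝ)⁻¹ / 4) < 0 by linarith))
  have hE := Real.exp_pos (2 * π)
  have hy : Tendsto (fun y : ℝ => y / Real.exp (2 * π)) atTop atTop :=
    tendsto_id.atTop_div_const hE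
  have hl := Real.tendsto_log_atTop.comp hy
  filter_upwards [hl.eventually h1, hl.eventually J_lower, eventually_gt_atTop 0] with y h2 h3 h4
  have h5 := psi_aux a ha (y / Real.exp (2 * π)) (by positivity)
  rw [div_mul_cancel₀ _ hE.ne'] at h5
  simp only [Function.comp] at h2 h3
  have hpi := Real.pi_gt_three
  have h6 : (m.totient : ℝ)⁻¹ ≤ 2 * Real.exp (2 * π) / (y / Real.exp (2 * π)) *
      ∑ n ∈ Finset.range (⌊y⌋₊ + 1), residueClass a n := by
    refine le_trans ?_ h5
    nlinarith
  have e4 : Real.exp (4 * π) = Real.exp (2 * π) * Real.exp (2 * π) := by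
    rw [← Real.exp_add]; congr 1; ring
  rw [e4]
  rw [show 2 * Real.exp (2 * π) / (y / Real.exp (2 * π)) =
    2 * (Real.exp (2 * π) * Real.exp (2 * π)) / y by field_simp] at h6
  have h7 := mul_le_mul_of_nonneg_left h6
    (by positivity : 0 ≤ 1 / (2 * (Real.exp (2 * π) * Real.exp (2 * π))) * y)
  refine le_trans (le_of_eq (div_eq_mul_inv _ _)) (h7.trans (le_of_eq ?_))
  field_simp


lemma sqrt_log_small (δ : ℝ) (hδ : 0 < δ) : ∀ᶠ y : ℝ in atTop, 2 * √y * Real.log y ≤ δ * y := by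
  have h := (isLittleO_log_rpow_atTop (r := 1/2) (by norm_num)).bound (half_pos hδ)
  filter_upwards [h, eventually_ge_atTop 1] with y h1 h2
  rw [Real.norm_eq_abs, Real.norm_eq_abs, ← Real.sqrt_eq_rpow, abs_of_nonneg (Real.sqrt_nonneg y)] at h1
  have h3 := (le_abs_self _).trans h1
  have h4 := Real.mul_self_sqrt (by linarith : 0 ≤ y)
  calc 2 * √y * Real.log y ≤ 2 * √y * (δ / 2 * √y) := by gcongr
    _ = δ * (√y * √y) := by ring
    _ = δ * y := by rw [h4]

open ArithmeticFunction.vonMangoldt in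
lemma res_le {m : ℕ} (a : ZMod m) (B : ℕ) (y : ℝ) (hy : 1 ≤ y) :
    ∑ n ∈ Finset.range (⌊y⌋₊ + 1), residueClass a n ≤
      (((Finset.range (⌊y⌋₊ + 1)).filter
        (fun r : ℕ => r.Prime ∧ B < r ∧ (r : ZMod m) = a)).card : ℝ) * Real.log y
      + (∑ n ∈ Finset.range (B + 1), ArithmeticFunction.vonMangoldt n) + 2 * √y * Real.log y := by
  classical
  have hv : ∀ n, 0 ≤ ArithmeticFunction.vonMangoldt n := fun n =>
    ArithmeticFunction.vonMangoldt_nonneg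
  have h1 : ∀ n ∈ Finset.range (⌊y⌋₊ + 1), residueClass a n ≤
      (if n.Prime ∧ B < n ∧ (n : ZMod m) = a then Real.log y else 0)
      + (if n ∈ Finset.range (B + 1) then ArithmeticFunction.vonMangoldt n else 0)
      + (if ¬ n.Prime then ArithmeticFunction.vonMangoldt n else 0) := by
    intro n hn
    have hly := Real.log_nonneg hy
    have hvn := hv n
    by_cases ha : (n : ZMod m) = a
    · have e : residueClass a n = ArithmeticFunction.vonMangoldt n :=
        Set.indicator_of_mem (s := {n : ℕ | (n : ZMod m) = a}) ha _
      rw [e]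
      by_cases hp : n.Prime
      · by_cases hB : B < n
        · rw [if_pos ⟨hp, hB, ha⟩, if_neg (by simp; omega), if_neg (by simpa using hp),
            ArithmeticFunction.vonMangoldt_apply_prime hp]
          simp only [add_zero]
          apply Real.log_le_log (by exact_mod_cast hp.pos)
          rw [Finset.mem_range, Nat.lt_succ_iff] at hn
          exact (Nat.le_floor_iff (by linarith)).1 hn
        · rw [if_neg (by tauto), if_pos (by simp; omega), if_neg (by simpa using hp)]
          simp
      · rw [if_pos hp, if_neg (by tauto)]
        have : 0 ≤ (if n ∈ Finset.range (B + 1) then ArithmeticFunction.vonMangoldt n else 0) := by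
          split_ifs <;> simp [hvn]
        linarith
    · have e : residueClass a n = 0 :=
        Set.indicator_of_notMem (s := {n : ℕ | (n : ZMod m) = a}) ha _
      rw [e]
      positivity
  refine (Finset.sum_le_sum h1).trans ?_
  rw [Finset.sum_add_distrib, Finset.sum_add_distrib]
  refine add_le_add (add_le_add (le_of_eq ?_) ?_) ?_
  · rw [← Finset.sum_filter, Finset.sum_const, nsmul_eq_mul]
  · rw [← Finset.sum_filter]
    refine Finset.sum_le_sum_of_subset_of_nonneg ?_ (fun n _ _ => hv n)
    intro n hn
    exact (Finset.mem_filter.1 hn).2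
  · have := Chebyshev.psi_sub_theta_le hy
    rw [Chebyshev.psi_sub_theta_eq_sum_not_prime] at this
    refine le_trans ?_ this
    rw [← Finset.sum_filter]
    apply le_of_eq
    symm
    apply Finset.sum_subset_zero_on_sdiff
    · intro n hn
      rw [Finset.mem_filter, Finset.mem_Ioc] at hn
      rw [Finset.mem_filter, Finset.mem_range]
      exact ⟨by omega, hn.2⟩
    · intro n hn
      simp only [Finset.mem_sdiff, Finset.mem_filter, Finset.mem_Ioc, Finset.mem_range] at hn
      have : n = 0 := by
        by_contra h0
        exact hn.2 ⟨⟨by omega, by omega⟩, hn.1.2⟩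
      simp [this]
    · intro n _; rfl

noncomputable def c0 : ℝ := 1 / (4 * Real.exp (4 * π))
lemma c0_pos : 0 < c0 := by unfold c0; positivity

lemma prime_ap {m : ℕ} [NeZero m] (a : ZMod m) (ha : IsUnit a) (B : ℕ) :
    ∀ᶠ y : ℝ in atTop, c0 * y / m.totient ≤
      (((Finset.range (⌊y⌋₊ + 1)).filter
        (fun r : ℕ => r.Prime ∧ B < r ∧ (r : ZMod m) = a)).card : ℝ) * Real.log y := by
  have hm : (0:ℝ) < m.totient := by exact_mod_cast Nat.totient_pos.2 (NeZero.pos m)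
  have hc := c0_pos
  set K := ∑ n ∈ Finset.range (B + 1), ArithmeticFunction.vonMangoldt n with hK
  filter_upwards [psi_lower a ha, sqrt_log_small (c0 / (2 * m.totient)) (by positivity),
    eventually_ge_atTop 1, eventually_ge_atTop (K * (2 * m.totient / c0))] with y h1 h2 h3 h4
  have h5 := h1.trans (res_le a B y h3)
  rw [← hK] at h5
  have h6 : K ≤ c0 / (2 * m.totient) * y := by
    calc K = c0 / (2 * m.totient) * (K * (2 * m.totient / c0)) := by field_simp
      _ ≤ _ := by gcongr
  have e : (1 / (2 * Real.exp (4 * π))) * y / m.totient = c0 * y / m.totient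
     + c0 / (2 * m.totient) * y + c0 / (2 * m.totient) * y := by
    unfold c0
    field_simp
    ring
  rw [e] at h5
  linarith


/-- good `r` for a given `q`. -/
noncomputable def Gset (q : ℕ) (y : ℝ) : Finset ℕ := by
  classical
  exact (Finset.range (⌊y⌋₊ + 1)).filter
    (fun r : ℕ => r.Prime ∧ q < r ∧ polyHeight (cyclotomic (3 * q * r) ℤ) = 1)

def tk (q k : ℕ) : ℕ := 3 * k + (3 - q % 3)

lemma q_mod3 (q : ℕ) (hq : q.Prime) (h : 13 ≤ q) : q % 3 ≠ 0 := by
  intro h0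
  have h1 : 3 ∣ q := Nat.dvd_of_mod_eq_zero h0
  have := (Nat.prime_dvd_prime_iff_eq Nat.prime_three hq).1 h1
  omega

lemma tk_coprime (q k : ℕ) (hq : q.Prime) (h : 13 ≤ q) (hk : k < (q - 4) / 6) :
    Nat.Coprime (tk q k) (3 * q) := by
  have h3 := q_mod3 q hq h
  apply Nat.Coprime.mul_right
  · rw [Nat.coprime_comm, Nat.Prime.coprime_iff_not_dvd Nat.prime_three]
    unfold tk
    omega
  · rw [Nat.coprime_comm, Nat.Prime.coprime_iff_not_dvd hq]
    intro hd
    have h1 : 0 < tk q k := by unfold tk; omega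
    have h2 := Nat.le_of_dvd h1 hd
    unfold tk at h2
    omega

lemma good_r (q k r : ℕ) (hq : q.Prime) (h : 13 ≤ q) (hk : k < (q - 4) / 6) (hr : r.Prime)
    (hqr : q < r) (he : (r : ZMod (3 * q)) = (tk q k : ZMod (3 * q))⁻¹) :
    polyHeight (cyclotomic (3 * q * r) ℤ) = 1 := by
  have h3 := q_mod3 q hq h
  refine flat_of q r (tk q k) hq hr (by omega) hqr ?_ ?_ ?_ ?_
  · have h1 : ((r : ZMod (3 * q)) * (tk q k : ZMod (3 * q))) = 1 := by
      rw [he]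
      exact (mul_comm _ _).trans (ZMod.coe_mul_inv_eq_one _ (tk_coprime q k hq h hk))
    have h2 : (((r : ℤ) * (tk q k : ℤ) - 1 : ℤ) : ZMod (3 * q)) = 0 := by
      push_cast
      rw [h1, sub_self]
    have := (ZMod.intCast_zmod_eq_zero_iff_dvd _ (3 * q)).1 h2
    exact_mod_cast this
  · unfold tk; omega
  · unfold tk; omega
  · unfold tk; omega

lemma G_lower (q : ℕ) (hq : q.Prime) (h : 13 ≤ q) : ∀ᶠ y : ℝ in atTop,
    c0 / 40 * y ≤ ((Gset q y).card : ℝ) * Real.log y := by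
  classical
  have : NeZero (3 * q) := ⟨by omega⟩
  have hall : ∀ᶠ y : ℝ in atTop, ∀ k ∈ Finset.range ((q - 4) / 6),
      c0 * y / (3 * q).totient ≤ (((Finset.range (⌊y⌋₊ + 1)).filter
        (fun r : ℕ => r.Prime ∧ q < r ∧ (r : ZMod (3 * q)) = (tk q k : ZMod (3 * q))⁻¹)).card : ℝ)
        * Real.log y := by
    rw [Filter.eventually_all_finset]
    intro k hk
    apply prime_ap
    have := tk_coprime q k hq h (Finset.mem_range.1 hk)
    exact IsUnit.of_mul_eq_one (tk q k : ZMod (3 * q))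
      ((mul_comm _ _).trans (ZMod.coe_mul_inv_eq_one _ this))
  filter_upwards [hall, eventually_ge_atTop 1] with y h1 hy
  have hlog := Real.log_nonneg hy
  have hsub : (Finset.range ((q - 4) / 6)).biUnion (fun k => (Finset.range (⌊y⌋₊ + 1)).filter
        (fun r : ℕ => r.Prime ∧ q < r ∧ (r : ZMod (3 * q)) = (tk q k : ZMod (3 * q))⁻¹))
      ⊆ Gset q y := by
    intro r hr
    simp only [Finset.mem_biUnion, Finset.mem_filter] at hr
    obtain ⟨k, hk, hr1, hr2, hr3, hr4⟩ := hr
    unfold Gset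
    rw [Finset.mem_filter]
    exact ⟨hr1, hr2, hr3, good_r q k r hq h (Finset.mem_range.1 hk) hr2 hr3 hr4⟩
  have hcard := Finset.card_le_card hsub
  rw [Finset.card_biUnion] at hcard
  · have h2 := Finset.sum_le_sum h1
    rw [Finset.sum_const, Finset.card_range, nsmul_eq_mul, ← Finset.sum_mul] at h2
    have hcard' : (∑ k ∈ Finset.range ((q - 4) / 6), (((Finset.range (⌊y⌋₊ + 1)).filter
        (fun r : ℕ => r.Prime ∧ q < r ∧ (r : ZMod (3 * q)) = (tk q k : ZMod (3 * q))⁻¹)).card : ℝ))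
        ≤ ((Gset q y).card : ℝ) := by exact_mod_cast hcard
    refine le_trans ?_ (h2.trans (mul_le_mul_of_nonneg_right hcard' hlog))
    have htot : (3 * q).totient = 2 * (q - 1) := by
      rw [Nat.totient_mul, Nat.totient_prime Nat.prime_three, Nat.totient_prime hq]
      rw [Nat.coprime_primes Nat.prime_three hq]
      omega
    have ht1 : ((3 * q).totient : ℝ) ≤ 2 * q := by
      rw [htot]
      exact_mod_cast (by omega : 2 * (q - 1) ≤ 2 * q)
    have ht0 : (0:ℝ) < ((3 * q).totient : ℝ) := by
      rw [htot]
      exact_mod_cast (by omega : 0 < 2 * (q - 1))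
    have hN : (q : ℝ) ≤ 20 * (((q - 4) / 6 : ℕ) : ℝ) := by
      exact_mod_cast (by omega : q ≤ 20 * ((q - 4) / 6))
    have hc := c0_pos
    have hcy : 0 ≤ c0 * y := by positivity
    rw [← mul_div_assoc, le_div_iff₀ ht0]
    nlinarith [mul_le_mul_of_nonneg_left ht1 hcy, mul_le_mul_of_nonneg_left hN hcy]
  · intro i hi j hj hij
    rw [Function.onFun, Finset.disjoint_left]
    intro r hr hr'
    rw [Finset.mem_filter] at hr hr'
    apply hij
    have hi' : i < (q - 4) / 6 := by simpa using hi
    have hj' : j < (q - 4) / 6 := by simpa using hj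
    have e1 := ZMod.coe_mul_inv_eq_one _ (tk_coprime q i hq h hi')
    have e2 := ZMod.coe_mul_inv_eq_one _ (tk_coprime q j hq h hj')
    have e3 := hr.2.2.2.symm.trans hr'.2.2.2
    have e4 : (tk q i : ZMod (3 * q)) = (tk q j : ZMod (3 * q)) := by
      calc (tk q i : ZMod (3 * q)) = tk q i * (tk q j * (tk q j : ZMod (3 * q))⁻¹) := by
            rw [e2, mul_one]
        _ = tk q j * (tk q i * (tk q i : ZMod (3 * q))⁻¹) := by rw [e3]; ring
        _ = _ := by rw [e1, mul_one]
    rw [ZMod.natCast_eq_natCast_iff', Nat.mod_eq_of_lt (by unfold tk; omega),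
      Nat.mod_eq_of_lt (by unfold tk; omega)] at e4
    unfold tk at e4
    omega

noncomputable def Fset (x : ℝ) : Set ℕ := {n : ℕ | ∃ p q r : ℕ, p.Prime ∧ q.Prime ∧ r.Prime ∧
    3 ≤ p ∧ p < q ∧ q < r ∧ n = p * q * r ∧ (n : ℝ) ≤ x ∧
    polyHeight (Polynomial.cyclotomic n ℤ) = 1}

lemma Fset_lower (S : Finset ℕ) (hS : ∀ q ∈ S, q.Prime ∧ 13 ≤ q) (x : ℝ) (hx : 0 ≤ x) :
    ∑ q ∈ S, (Gset q (x / (3 * q))).card ≤ (Fset x).ncard := by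
  classical
  have hfin : (Fset x).Finite := by
    refine (Set.finite_Iic ⌊x⌋₊).subset ?_
    rintro n ⟨p, q, r, h⟩
    exact Nat.le_floor h.2.2.2.2.2.2.2.1
  have hG : ∀ q r : ℕ, r ∈ Gset q (x / (3 * q)) → (r : ℝ) ≤ x / (3 * q) ∧ r.Prime ∧ q < r ∧
      polyHeight (cyclotomic (3 * q * r) ℤ) = 1 := by
    intro q r hr
    unfold Gset at hr
    rw [Finset.mem_filter, Finset.mem_range, Nat.lt_succ_iff] at hr
    exact ⟨(Nat.le_floor_iff (by positivity)).1 hr.1, hr.2⟩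
  have hinj : Set.InjOn (fun z : (_ : ℕ) × ℕ => 3 * z.1 * z.2)
      ((S.sigma fun q => Gset q (x / (3 * q)) : Finset ((_ : ℕ) × ℕ)) : Set ((_ : ℕ) × ℕ)) := by
    rintro ⟨q, r⟩ h1 ⟨q', r'⟩ h2 heq
    simp only [Finset.mem_coe, Finset.mem_sigma] at h1 h2
    dsimp only at heq
    have a1 := hS q h1.1
    have a2 := hS q' h2.1
    obtain ⟨_, b1, c1, _⟩ := hG q r h1.2
    obtain ⟨_, b2, c2, _⟩ := hG q' r' h2.2
    have e : q * r = q' * r' := by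
      rw [mul_assoc, mul_assoc] at heq
      omega
    have hd : q ∣ q' * r' := ⟨r, e.symm⟩
    rcases (Nat.Prime.dvd_mul a1.1).1 hd with hd | hd
    · have hqq := (Nat.prime_dvd_prime_iff_eq a1.1 a2.1).1 hd
      subst hqq
      have := Nat.eq_of_mul_eq_mul_left a1.1.pos e
      subst this
      rfl
    · have hqq := (Nat.prime_dvd_prime_iff_eq a1.1 b2).1 hd
      subst hqq
      rw [mul_comm] at e
      have := Nat.eq_of_mul_eq_mul_right a1.1.pos e
      omega
  have hsub : (((S.sigma fun q => Gset q (x / (3 * q))).image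
      (fun z : (_ : ℕ) × ℕ => 3 * z.1 * z.2) : Finset ℕ) : Set ℕ) ⊆ Fset x := by
    intro n hn
    simp only [Finset.coe_image, Set.mem_image, Finset.mem_coe, Finset.mem_sigma] at hn
    obtain ⟨⟨q, r⟩, ⟨h1, h2⟩, rfl⟩ := hn
    dsimp only at h1 h2
    have a1 := hS q h1
    obtain ⟨a, b, c, d⟩ := hG q r h2
    refine ⟨3, q, r, Nat.prime_three, a1.1, b, le_rfl, by omega, c, rfl, ?_, d⟩
    have hq0 : (0:ℝ) < 3 * q := by exact_mod_cast (by omega : 0 < 3 * q)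
    rw [le_div_iff₀ hq0] at a
    push_cast
    linarith
  have h := Set.ncard_le_ncard hsub hfin
  rw [Set.ncard_coe_finset, Finset.card_image_of_injOn hinj, Finset.card_sigma] at h
  exact h

lemma exists_S (T : ℝ) : ∃ S : Finset ℕ, (∀ q ∈ S, q.Prime ∧ 13 ≤ q) ∧
    T ≤ ∑ q ∈ S, (1 : ℝ) / q := by
  classical
  by_contra hcon
  push Not at hcon
  apply Nat.Primes.not_summable_one_div
  have h0 : ∀ n : ℕ, 0 ≤ (if n.Prime ∧ 13 ≤ n then (1 : ℝ) / n else 0) := by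
    intro n; split_ifs <;> positivity
  have hs : Summable (fun n : ℕ => if n.Prime ∧ 13 ≤ n then (1 : ℝ) / n else 0) := by
    refine summable_of_sum_le (c := T) h0 ?_
    intro u
    rw [← Finset.sum_filter]
    refine (hcon _ ?_).le
    intro q hq
    exact (Finset.mem_filter.1 hq).2
  have hs2 := hs.comp_injective (i := fun p : Nat.Primes => (p : ℕ)) Subtype.coe_injective
  refine hs2.congr_cofinite ?_
  have : {p : Nat.Primes | (p : ℕ) < 13}.Finite :=
    (Set.finite_Iio 13).preimage Subtype.coe_injective.injOn
  filter_upwards [this.compl_mem_cofinite] with p hp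
  simp only [Set.mem_compl_iff, Set.mem_ofPred_eq, not_lt] at hp
  simp [Function.comp, p.2, hp]

lemma final_bound (C : ℝ) : ∃ x₀ : ℝ, ∀ x ≥ x₀, C * x / Real.log x ≤ ((Fset x).ncard : ℝ) := by
  have hc := c0_pos
  obtain ⟨S, hS, hT⟩ := exists_S (C * 120 / c0)
  have hall : ∀ᶠ x : ℝ in atTop, ∀ q ∈ S,
      c0 / 40 * (x / (3 * q)) ≤ ((Gset q (x / (3 * q))).card : ℝ) * Real.log (x / (3 * q)) := by
    rw [Filter.eventually_all_finset]
    intro q hq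
    have hq0 : (0:ℝ) < 3 * q := by
      have := (hS q hq).2
      exact_mod_cast (by omega : 0 < 3 * q)
    have : Tendsto (fun x : ℝ => x / (3 * q)) atTop atTop := tendsto_id.atTop_div_const hq0
    exact this.eventually (G_lower q (hS q hq).1 (hS q hq).2)
  rw [← Filter.eventually_atTop]
  filter_upwards [hall, eventually_gt_atTop 1] with x h1 hx
  have hlog := Real.log_pos hx
  rw [div_le_iff₀ hlog]
  have h2 : ∀ q ∈ S, c0 * x / 120 * (1 / q) ≤
      ((Gset q (x / (3 * q))).card : ℝ) * Real.log x := by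
    intro q hq
    have hq1 : (1:ℝ) ≤ q := by
      have := (hS q hq).2
      exact_mod_cast (by omega : 1 ≤ q)
    have hle : x / (3 * q) ≤ x := div_le_self (by linarith) (by linarith)
    have hlg : Real.log (x / (3 * q)) ≤ Real.log x := Real.log_le_log (by positivity) hle
    calc c0 * x / 120 * (1 / q) = c0 / 40 * (x / (3 * q)) := by field_simp; norm_num
      _ ≤ _ := h1 q hq
      _ ≤ _ := by gcongr
  have h3 := Finset.sum_le_sum h2
  rw [← Finset.mul_sum, ← Finset.sum_mul] at h3
  have h4 : ∑ q ∈ S, ((Gset q (x / (3 * q))).card : ℝ) ≤ ((Fset x).ncard : ℝ) := by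
    exact_mod_cast Fset_lower S hS x (by linarith)
  calc C * x = c0 * x / 120 * (C * 120 / c0) := by field_simp
    _ ≤ c0 * x / 120 * ∑ q ∈ S, (1 : ℝ) / q := by gcongr
    _ ≤ _ := h3
    _ ≤ _ := mul_le_mul_of_nonneg_right h4 hlog.le

theorem Fcount_lower_bound :
    ∀ ε > (0 : ℝ), ∃ x₀ : ℝ, ∀ x ≥ x₀,
      (Fcount x : ℝ) ≥ (2 * C2 - ε) * x / Real.log x := by
  intro ε hε
  obtain ⟨x₀, h⟩ := final_bound (2 * C2 - ε)
  exact ⟨x₀, fun x hx => h x hx⟩
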